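/- Let V be a nonlocal vertex algebra, U a generating subspace of V, and W a vector space equipped with a linear map Y_W⁰ from U to Hom(W, W((x))) such that {Y_W⁰(u,x) : u ∈ U} ⊂ ℰ(W) is quasi compatible. Then Y_W⁰ can be extended (uniquely) to a linear map Y_W from V to Hom(W, W((x))) such that (W, Y_W) carries the structure of a quasi V-module if and only if there exists a linear map f from V to ⟨Y_W⁰(U)⟩ such that f(1) = 1_W and f(u_n v) = u(x)_n f(v) for all u ∈ U, v ∈ V, n ∈ ℤ (where u(x) = Y_W⁰(u,x)). -/

import Mathlib

noncomputable section

open Classical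

namespace NVA

/-! ### The space ℰ(W) = Hom(W, W((x))), coefficient-indexed by modes:
`a w n` is the mode `a_n` applied to `w`, where `a(x)w = ∑ (a_n w) x^{-n-1}`.
Lower truncation of `a(x)w` in powers of `x` means `a_n w = 0` for `n` large. -/

variable (W : Type*) [AddCommGroup W] [Module ℂ W]

/-- `ℰ(W) = Hom(W, W((x)))` as a submodule of `Hom(W, W[[x^{±1}]])`. -/
def EWsub : Submodule ℂ (W →ₗ[ℂ] (ℤ → W)) where
  carrier := {a | ∀ w : W, ∃ N : ℤ, ∀ n : ℤ, N ≤ n → a w n = 0}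
  add_mem' := by
    intro a b ha hb w
    obtain ⟨N, hN⟩ := ha w
    obtain ⟨M, hM⟩ := hb w
    refine ⟨max N M, fun n hn => ?_⟩
    simp only [LinearMap.add_apply, Pi.add_apply,
      hN n (le_trans (le_max_left _ _) hn), hM n (le_trans (le_max_right _ _) hn), add_zero]
  zero_mem' := by intro w; exact ⟨0, fun n _ => rfl⟩
  smul_mem' := by
    intro c a ha w
    obtain ⟨N, hN⟩ := ha w
    exact ⟨N, fun n hn => by
      simp only [LinearMap.smul_apply, Pi.smul_apply, hN n hn, smul_zero]⟩

/-- The type `ℰ(W)`. -/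
abbrev EW := ↥(EWsub W)

variable {W}

/-- The mode function of an element of `ℰ(W)`. -/
def mf (a : EW W) : W → ℤ → W := fun w n => (a : W →ₗ[ℂ] (ℤ → W)) w n

/-- The identity operator `1_W`, as an element of `ℰ(W)`. -/
def oneE : EW W :=
  ⟨{ toFun := fun w n => if n = -1 then w else 0
     map_add' := by
       intro w w'; funext n; by_cases h : n = -1 <;> simp [h]
     map_smul' := by
       intro c w; funext n; by_cases h : n = -1 <;> simp [h] },
   fun w => ⟨0, fun n hn => if_neg (by omega)⟩⟩

/-- The generalized binomial coefficient `C(m, j)` for `m ∈ ℤ`, as a complex number. -/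
def binom (m : ℤ) (j : ℕ) : ℂ :=
  (∏ i ∈ Finset.range j, ((m : ℂ) - (i : ℂ))) / (j.factorial : ℂ)

/-- The coefficient of `x₁^m x₂^t` in `a(x₁) b(x₂) w`. -/
def Fab (a b : EW W) (w : W) (m t : ℤ) : W := mf a (mf b w (-t - 1)) (-m - 1)

/-- Multiplication of a two-variable family by a polynomial `p(x₁,x₂)`. -/
def mulPoly (p : MvPolynomial (Fin 2) ℂ) (F : ℤ → ℤ → W) : ℤ → ℤ → W :=
  fun m t => ∑ d ∈ p.support, MvPolynomial.coeff d p • F (m - d 0) (t - d 1)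

/-- A two-variable family lies in `W((x₁,x₂))` (jointly lower truncated). -/
def IsLaurent2 (F : ℤ → ℤ → W) : Prop :=
  ∃ N : ℤ, ∀ m t : ℤ, (m < N ∨ t < N) → F m t = 0

/-- Quasi compatibility of an ordered pair `(a(x), b(x))` in `ℰ(W)`:
`p(x₁,x₂) a(x₁) b(x₂) ∈ Hom(W, W((x₁,x₂)))` for some nonzero polynomial `p`. -/
def QCPair (a b : EW W) : Prop :=
  ∃ p : MvPolynomial (Fin 2) ℂ, p ≠ 0 ∧ ∀ w, IsLaurent2 (mulPoly p (Fab a b w))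

/-! ### Sequences -/

/-- The coefficient of `x₁^{k 1} ⋯ x_r^{k r}` in `ψ₁(x₁) ⋯ ψ_r(x_r) w`. -/
def seqCoeff : {r : ℕ} → (Fin r → EW W) → W → (Fin r → ℤ) → W
  | 0, _, w, _ => w
  | _ + 1, ψ, w, k => mf (ψ 0) (seqCoeff (Fin.tail ψ) w (Fin.tail k)) (-(k 0) - 1)

/-- The polynomial `∏_{1 ≤ i < j ≤ r} p(x_i, x_j)`. -/
def pairPoly (p : MvPolynomial (Fin 2) ℂ) (r : ℕ) : MvPolynomial (Fin r) ℂ :=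
  ∏ ij ∈ Finset.univ.filter (fun ij : Fin r × Fin r => ij.1 < ij.2),
    MvPolynomial.rename ![ij.1, ij.2] p

/-- Multiplication of an `r`-variable family by a polynomial in `r` variables. -/
def mulPolyN {r : ℕ} (P : MvPolynomial (Fin r) ℂ) (F : (Fin r → ℤ) → W) :
    (Fin r → ℤ) → W :=
  fun k => ∑ d ∈ P.support, MvPolynomial.coeff d P • F (fun i => k i - d i)

/-- An `r`-variable family lies in `W((x₁,…,x_r))`. -/
def IsLaurentN {r : ℕ} (F : (Fin r → ℤ) → W) : Prop :=
  ∃ N : ℤ, ∀ k : Fin r → ℤ, (∃ i, k i < N) → F k = 0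

/-- Quasi compatibility of an ordered sequence in `ℰ(W)`. -/
def QCSeq {r : ℕ} (ψ : Fin r → EW W) : Prop :=
  ∃ p : MvPolynomial (Fin 2) ℂ, p ≠ 0 ∧
    ∀ w, IsLaurentN (mulPolyN (pairPoly p r) (seqCoeff ψ w))

/-- Quasi compatibility of a subset of `ℰ(W)`. -/
def QCSet (S : Set (EW W)) : Prop :=
  ∀ (r : ℕ) (ψ : Fin r → EW W), (∀ i, ψ i ∈ S) → QCSeq ψ

/-! ### The vertex operation `Y_ℰ^{(α)}` -/

/-- `ℂ((x))`. -/
abbrev LC : Type := LaurentSeries ℂ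

/-- An iterated Laurent series field, e.g. `ℂ((x))((x₀))` (outer variable the second one). -/
abbrev K2 : Type := HahnSeries ℤ LC

/-- The outer variable of `K2`. -/
def xOuter : K2 := HahnSeries.single 1 1

/-- The inner variable of `K2`. -/
def xInner : K2 := HahnSeries.single 0 (HahnSeries.single 1 1)

/-- `α` times the inner variable of `K2`. -/
def xInnerC (c : ℂ) : K2 := HahnSeries.single 0 (HahnSeries.single 1 c)

/-- The polynomial `p(x₀ + α x, x)` as an element of `ℂ((x))((x₀))`
(outer variable `x₀`). -/
def qK (p : MvPolynomial (Fin 2) ℂ) (α : ℂ) : K2 :=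
  MvPolynomial.aeval ![xOuter + xInnerC α, xInner] p

/-- The expansion `ι_{x,x₀} (p(x₀ + α x, x)^{-1}) ∈ ℂ((x))((x₀))`. -/
def qInv (p : MvPolynomial (Fin 2) ℂ) (α : ℂ) : K2 := (qK p α)⁻¹

/-- The coefficient of `x₀^j x^t` in `(p(x₁,x) a(x₁) b(x) w)|_{x₁ = αx + x₀}`,
expanding via `(αx+x₀)^m = ∑_{j≥0} C(m,j) α^{m-j} x^{m-j} x₀^j`. -/
def substYE (α : ℂ) (p : MvPolynomial (Fin 2) ℂ) (a b : EW W) (w : W)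
    (j : ℕ) (t : ℤ) : W :=
  ∑ᶠ m : ℤ, (binom m j * α ^ (m - (j : ℤ))) • mulPoly p (Fab a b w) m (t - m + j)

/-- The coefficient of `x₀^J x^T` in
`ι_{x,x₀}(p(x₀+αx,x)^{-1}) ⬝ (p(x₁,x)a(x₁)b(x)w)|_{x₁ = αx+x₀}`. -/
def fullYE (α : ℂ) (p : MvPolynomial (Fin 2) ℂ) (a b : EW W) (w : W)
    (J T : ℤ) : W :=
  ∑ᶠ s : ℤ × ℤ, (((qInv p α).coeff s.1).coeff s.2) •
    (if 0 ≤ J - s.1 then substYE α p a b w (J - s.1).toNat (T - s.2) else 0)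

/-- The raw mode family of `Y_ℰ^{(α)}(a(x), x₀) b(x)`; `rawYE α a b n w m` is the mode
`m` of the element `a(x)_{(α,n)} b(x)` applied to `w`.  (Defined using a choice of
polynomial from quasi compatibility; by the general theory the value does not depend
on the choice.) -/
def rawYE (α : ℂ) (a b : EW W) (n : ℤ) (w : W) (m : ℤ) : W :=
  if h : QCPair a b then fullYE α h.choose a b w (-n - 1) (-m - 1) else 0

/-- `a(x)_{(α,n)} b(x)`, as an element of `ℰ(W)` whenever the raw family is realized
by one (which is the case for any quasi compatible pair). -/
def YEa (α : ℂˣ) (a b : EW W) (n : ℤ) : EW W :=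
  if h : ∃ c : EW W, ∀ w m, mf c w m = rawYE (α : ℂ) a b n w m then h.choose else 0

/-- `a(x)_n b(x) = a(x)_{(1,n)} b(x)`. -/
def YE (a b : EW W) (n : ℤ) : EW W := YEa 1 a b n

end NVA

namespace NVA

variable {W : Type*} [AddCommGroup W] [Module ℂ W]

/-- Submodules of `ℰ(W)` are `ℂ`-vector spaces (registered explicitly to assist
instance resolution). -/
noncomputable instance (V : Submodule ℂ (EW W)) : AddCommGroup ↥V :=
  @Submodule.addCommGroup ℂ (EW W) _ inferInstance inferInstance V

noncomputable instance (V : Submodule ℂ (EW W)) : Module ℂ ↥V :=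
  @Submodule.module ℂ (EW W) _ inferInstance inferInstance V

/-! ### Derivative and scaling operators on ℰ(W) -/

/-- `D = d/dx` on `ℰ(W)`: `(Da)_m = -m • a_{m-1}`. -/
def Dop (a : EW W) : EW W :=
  ⟨{ toFun := fun w m => (-m : ℂ) • mf a w (m - 1)
     map_add' := by intro w w'; funext m; simp [mf, map_add]
     map_smul' := by
       intro c w; funext m
       simp only [mf, map_smul, Pi.smul_apply, RingHom.id_apply]
       exact smul_comm _ _ _ },
   by
     intro w
     obtain ⟨N, hN⟩ := a.2 w
     exact ⟨N + 1, fun m hm => by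
       have : (a : W →ₗ[ℂ] (ℤ → W)) w (m - 1) = 0 := hN _ (by omega)
       simp [mf, this]⟩⟩

/-- `R_α : a(x) ↦ a(αx)`, on modes `(R_α a)_m = α^{-m-1} a_m`. -/
def RaE (α : ℂˣ) (a : EW W) : EW W :=
  ⟨{ toFun := fun w m => ((α : ℂ) ^ (-m - 1 : ℤ)) • mf a w m
     map_add' := by intro w w'; funext m; simp [mf, map_add]
     map_smul' := by
       intro c w; funext m
       simp only [mf, map_smul, Pi.smul_apply, RingHom.id_apply]
       exact smul_comm _ _ _ },
   by
     intro w
     obtain ⟨N, hN⟩ := a.2 w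
     exact ⟨N, fun m hm => by simp [mf, hN m hm]⟩⟩

/-! ### Nonlocal vertex algebras, modules and quasi modules -/

/-- The coefficient of `x₀^a x₂^b` in `Y₁(u, x₀+x₂) (Y₂(v,x₂) w)`, where
`(x₀+x₂)^m` is expanded in nonnegative powers of `x₂`. -/
def prodCE {V : Type*} (Yo Yi : V → W → ℤ → W) (u v : V) (w : W) (a b : ℤ) : W :=
  ∑ᶠ m : ℤ, if a ≤ m then
    binom m (m - a).toNat • Yo u (Yi v w (-(b - (m - a)) - 1)) (-m - 1) else 0

/-- The coefficient of `x₀^a x₂^b` in `Y₂(Y₁(u,x₀)v, x₂) w`. -/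
def assocCE {V : Type*} (Y1 : V → V → ℤ → V) (Y2 : V → W → ℤ → W)
    (u v : V) (w : W) (a b : ℤ) : W :=
  Y2 (Y1 u v (-a - 1)) w (-b - 1)

/-- Multiplication of a two-variable family (in `x₀, x₂`) by `f(x₀+x₂, x₂)` for a
polynomial `f`, expanding `(x₀+x₂)^d` in nonnegative powers of `x₂`. -/
def mulSubPoly (f : MvPolynomial (Fin 2) ℂ) (A : ℤ → ℤ → W) (a b : ℤ) : W :=
  ∑ d ∈ f.support, ∑ i ∈ Finset.range (d 0 + 1),
    (MvPolynomial.coeff d f * ((d 0).choose i : ℂ)) •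
      A (a - ((d 0 : ℤ) - i)) (b - i - (d 1 : ℤ))

/-- A nonlocal vertex algebra structure on a ℂ-vector space `V`:
a linear map `Y : V → ℰ(V) = Hom(V, V((x)))` and a vacuum vector `1` such that
`Y(1,x)v = v`, `Y(v,x)1 ∈ V[[x]]` with constant term `v`, and weak associativity
holds. -/
structure NLVA (V : Type*) [AddCommGroup V] [Module ℂ V] where
  Y : V →ₗ[ℂ] EW V
  one : V
  vac : ∀ (v : V) (n : ℤ), mf (Y one) v n = if n = -1 then v else 0
  creation0 : ∀ (v : V) (n : ℤ), 0 ≤ n → mf (Y v) one n = 0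
  creation1 : ∀ v : V, mf (Y v) one (-1) = v
  wassoc : ∀ u v w : V, ∃ l : ℕ, ∀ a b : ℤ,
    mulSubPoly (MvPolynomial.X 0 ^ l)
      (prodCE (fun x => mf (Y x)) (fun x => mf (Y x)) u v w) a b =
    mulSubPoly (MvPolynomial.X 0 ^ l)
      (assocCE (fun x y n => mf (Y x) y n) (fun x => mf (Y x)) u v w) a b

/-- The mode maps of a nonlocal vertex algebra: `Yf A u v n = u_n v`. -/
def Yf {V : Type*} [AddCommGroup V] [Module ℂ V] (A : NLVA V) : V → V → ℤ → V :=
  fun u v n => mf (A.Y u) v n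

/-- Mode maps of a linear map `V → ℰ(W)`. -/
def YWf {V : Type*} [AddCommGroup V] [Module ℂ V] (YW : V →ₗ[ℂ] EW W) :
    V → W → ℤ → W := fun v w n => mf (YW v) w n

/-- `(W, Y_W)` is a quasi module for the nonlocal vertex algebra `A` on `V`. -/
def IsQuasiModule {V : Type*} [AddCommGroup V] [Module ℂ V] (A : NLVA V)
    (YW : V →ₗ[ℂ] EW W) : Prop :=
  (∀ (w : W) (n : ℤ), mf (YW A.one) w n = if n = -1 then w else 0) ∧
  ∀ (u v : V) (w : W), ∃ f : MvPolynomial (Fin 2) ℂ, f ≠ 0 ∧ ∀ a b : ℤ,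
    mulSubPoly f (prodCE (YWf YW) (YWf YW) u v w) a b =
    mulSubPoly f (assocCE (Yf A) (YWf YW) u v w) a b

/-- `(W, Y_W)` is a module for the nonlocal vertex algebra `A` on `V`. -/
def IsModule {V : Type*} [AddCommGroup V] [Module ℂ V] (A : NLVA V)
    (YW : V →ₗ[ℂ] EW W) : Prop :=
  (∀ (w : W) (n : ℤ), mf (YW A.one) w n = if n = -1 then w else 0) ∧
  ∀ (u v : V) (w : W), ∃ l : ℕ, ∀ a b : ℤ,
    mulSubPoly (MvPolynomial.X 0 ^ l) (prodCE (YWf YW) (YWf YW) u v w) a b =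
    mulSubPoly (MvPolynomial.X 0 ^ l) (assocCE (Yf A) (YWf YW) u v w) a b

end NVA

namespace NVA

variable {W : Type*} [AddCommGroup W] [Module ℂ W]
variable {V : Type*} [AddCommGroup V] [Module ℂ V]

/-! ### Pseudo-locality -/

/-- A power series `∑ f n x^n` as a Laurent series. -/
def psN (f : ℕ → ℂ) : LC := HahnSeries.ofPowerSeries ℤ ℂ (PowerSeries.mk f)

/-- `ι_{x₂,x₁}` of a formal power series `F(x₁,x₂) ∈ ℂ[[x₁,x₂]]`, given by its
coefficient function, as an element of `ℂ((x₂))((x₁))` (outer variable `x₁`). -/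
def psEmbed (F : ℕ → ℕ → ℂ) : K2 :=
  HahnSeries.ofPowerSeries ℤ LC (PowerSeries.mk (fun m => psN (F m)))

/-- The coefficient function of a polynomial in two variables. -/
def polyCoeffFun (g : MvPolynomial (Fin 2) ℂ) : ℕ → ℕ → ℂ :=
  fun m t => MvPolynomial.coeff (Finsupp.single 0 m + Finsupp.single 1 t) g

/-- `ι_{x₂,x₁}` of a polynomial in two variables. -/
def polyEmbed (g : MvPolynomial (Fin 2) ℂ) : K2 := psEmbed (polyCoeffFun g)

/-- The coefficient function of an element of `ℂ((x₂))((x₁))`: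
`k2Fun x m t` is the coefficient of `x₁^m x₂^t`. -/
def k2Fun (x : K2) : ℤ → ℤ → ℂ := fun m t => (x.coeff m).coeff t

/-- Multiplication of a two-variable family by a scalar-valued two-variable series. -/
def smulFam (c : ℤ → ℤ → ℂ) (G : ℤ → ℤ → W) : ℤ → ℤ → W :=
  fun m t => ∑ᶠ s : ℤ × ℤ, c s.1 s.2 • G (m - s.1) (t - s.2)

/-- Multiplication of a two-variable family by a Laurent polynomial
`p ∈ ℂ[x₁^{±1}, x₂^{±1}]` (recorded by its finitely supported coefficients). -/
def mulLPoly (p : (ℤ × ℤ) →₀ ℂ) (G : ℤ → ℤ → W) : ℤ → ℤ → W :=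
  fun m t => ∑ d ∈ p.support, p d • G (m - d.1) (t - d.2)

/-- A subset `S ⊆ ℰ(W)` is pseudo-local. -/
def PseudoLocal (S : Set (EW W)) : Prop :=
  ∀ a ∈ S, ∀ b ∈ S, ∃ p : (ℤ × ℤ) →₀ ℂ, p ≠ 0 ∧
    ∃ (r : ℕ) (F : Fin r → (ℕ → ℕ → ℂ)) (g : Fin r → MvPolynomial (Fin 2) ℂ)
      (u v : Fin r → EW W),
      (∀ i, g i ≠ 0) ∧ (∀ i, u i ∈ S) ∧ (∀ i, v i ∈ S) ∧
      ∀ (w : W) (m t : ℤ),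
        mulLPoly p (Fab a b w) m t =
          ∑ i, smulFam (k2Fun (psEmbed (F i) * (polyEmbed (g i))⁻¹))
            (fun m' t' => Fab (u i) (v i) w t' m') m t

/-- The coefficient of `x₁^m x₂^t` in `ι_{x₂,x₁} f(x₂ - x₁)`, for `f(x) ∈ ℂ((x))`. -/
def expandSub (f : LC) : ℤ → ℤ → ℂ :=
  fun m t => if 0 ≤ m then
    ((-1 : ℂ) ^ m.toNat * binom (t + m) m.toNat) * f.coeff (t + m) else 0

/-- A subset `S ⊆ ℰ(W)` is `𝒮`-local. -/
def SLocal (S : Set (EW W)) : Prop :=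
  ∀ a ∈ S, ∀ b ∈ S, ∃ (k : ℕ) (r : ℕ) (f : Fin r → LC) (u v : Fin r → EW W),
    (∀ i, u i ∈ S) ∧ (∀ i, v i ∈ S) ∧
    ∀ (w : W) (m t : ℤ),
      mulPoly ((MvPolynomial.X 0 - MvPolynomial.X 1) ^ k) (Fab a b w) m t =
        ∑ i, mulPoly ((MvPolynomial.X 0 - MvPolynomial.X 1) ^ k)
          (smulFam (expandSub (f i)) (fun m' t' => Fab (u i) (v i) w t' m')) m t

/-- `U` is the nonlocal vertex algebra `⟨S⟩` generated by `S`: the smallest closed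
quasi compatible subspace of `ℰ(W)` containing `S ∪ {1_W}`. -/
def IsGenVA (S : Set (EW W)) (U : Submodule ℂ (EW W)) : Prop :=
  QCSet (U : Set (EW W)) ∧ (∀ a ∈ U, ∀ b ∈ U, ∀ n : ℤ, YE a b n ∈ U) ∧
  oneE ∈ U ∧ S ⊆ U ∧
  ∀ U' : Submodule ℂ (EW W),
    (QCSet (U' : Set (EW W)) ∧ (∀ a ∈ U', ∀ b ∈ U', ∀ n : ℤ, YE a b n ∈ U') ∧
      oneE ∈ U' ∧ S ⊆ (U' : Set (EW W))) → U ≤ U'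

/-! ### 𝒮-locality for maps and weak quantum vertex algebras -/

/-- The `𝒮`-locality identity
`(x₁-x₂)^k Y(u,x₁)Y(v,x₂) = ∑ᵢ (x₁-x₂)^k ι_{x₂,x₁}(fᵢ(x₂-x₁)) Y(vᵢ,x₂)Y(uᵢ,x₁)`
at the level of coefficient families, for mode maps `Ym`. -/
def sLocPair {V : Type*} (Ym : V → W → ℤ → W) (k : ℕ) (u v : V) {r : ℕ}
    (f : Fin r → LC) (vi ui : Fin r → V) : Prop :=
  ∀ (w : W) (m t : ℤ),
    mulPoly ((MvPolynomial.X 0 - MvPolynomial.X 1) ^ k)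
      (fun m' t' => Ym u (Ym v w (-t' - 1)) (-m' - 1)) m t =
    ∑ i, mulPoly ((MvPolynomial.X 0 - MvPolynomial.X 1) ^ k)
      (smulFam (expandSub (f i))
        (fun m' t' => Ym (vi i) (Ym (ui i) w (-m' - 1)) (-t' - 1))) m t

/-- A weak quantum vertex algebra: a nonlocal vertex algebra whose vertex operators
form an `𝒮`-local subspace of `ℰ(V)`. -/
def IsWeakQVA (A : NLVA V) : Prop :=
  ∀ u v : V, ∃ (k : ℕ) (r : ℕ) (f : Fin r → LC) (vi ui : Fin r → V),
    sLocPair (Yf A) k u v f vi ui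

end NVA

namespace NVA

variable {V : Type*} [AddCommGroup V] [Module ℂ V]

/-- A subspace `P` of a nonlocal vertex algebra is a subalgebra: it contains `1`
and is stable under all the products. -/
def IsSubVA (A : NLVA V) (P : Submodule ℂ V) : Prop :=
  A.one ∈ P ∧ ∀ a ∈ P, ∀ b ∈ P, ∀ n : ℤ, Yf A a b n ∈ P

/-- `U` generates the nonlocal vertex algebra `A`: the only subalgebra containing
`U` is `V` itself. -/
def Generates (A : NLVA V) (U : Submodule ℂ V) : Prop :=
  ∀ P : Submodule ℂ V, IsSubVA A P → U ≤ P → P = ⊤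

/-! ### Polynomial actions on families of coefficients -/

/-- A linear relation stable under the generators of two polynomial actions is stable under
the actions of all polynomials. -/
theorem act_mem_of_generators {σ M M' : Type*} [AddCommGroup M] [Module ℂ M]
    [AddCommGroup M'] [Module ℂ M']
    (φ : MvPolynomial σ ℂ →ₐ[ℂ] Module.End ℂ M) (φ' : MvPolynomial σ ℂ →ₐ[ℂ] Module.End ℂ M')
    (R : Submodule ℂ (M × M'))
    (h : ∀ i s g, (s, g) ∈ R → (φ (MvPolynomial.X i) s, φ' (MvPolynomial.X i) g) ∈ R)
    (p : MvPolynomial σ ℂ) {s : M} {g : M'} (hs : (s, g) ∈ R) : (φ p s, φ' p g) ∈ R := by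
  induction p using MvPolynomial.induction_on generalizing s g with
  | C c =>
    have h1 : φ (MvPolynomial.C c) s = c • s := by
      rw [← MvPolynomial.algebraMap_eq, AlgHom.commutes]; rfl
    have h2 : φ' (MvPolynomial.C c) g = c • g := by
      rw [← MvPolynomial.algebraMap_eq, AlgHom.commutes]; rfl
    rw [h1, h2]
    exact R.smul_mem c hs
  | add p q hp hq =>
    rw [map_add, map_add]
    exact R.add_mem (hp hs) (hq hs)
  | mul_X p i hp =>
    rw [map_mul, map_mul]
    exact hp (h i s g hs)

section Act

variable {Γ σ W : Type*} [AddCommGroup Γ] [AddCommGroup W] [Module ℂ W]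

/-- The translation action on families of coefficients. -/
def shiftHom (Γ W : Type*) [AddCommGroup Γ] [AddCommGroup W] [Module ℂ W] :
    Multiplicative Γ →* Module.End ℂ (Γ → W) where
  toFun g := LinearMap.funLeft ℂ W (fun h => h - g.toAdd)
  map_one' := by ext F h; simp [LinearMap.funLeft]
  map_mul' a b := by
    ext F h
    simp only [LinearMap.funLeft_apply, Module.End.mul_apply, toAdd_mul]
    congr 1; abel

/-- Multiplication of a family by a polynomial, with exponents embedded in `Γ` through `ι`. -/
def act (ι : (σ →₀ ℕ) →+ Γ) : MvPolynomial σ ℂ →ₐ[ℂ] Module.End ℂ (Γ → W) :=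
  AddMonoidAlgebra.lift ℂ _ _ ((shiftHom Γ W).comp (AddMonoidHom.toMultiplicative ι))

theorem act_apply (ι : (σ →₀ ℕ) →+ Γ) (p : MvPolynomial σ ℂ) (F : Γ → W) (g : Γ) :
    act ι p F g = ∑ d ∈ p.support, MvPolynomial.coeff d p • F (g - ι d) := by
  unfold act
  rw [AddMonoidAlgebra.lift_apply, Finsupp.sum, LinearMap.sum_apply, Finset.sum_apply]
  rfl

theorem act_X (ι : (σ →₀ ℕ) →+ Γ) (i : σ) (F : Γ → W) (g : Γ) :
    act ι (MvPolynomial.X i) F g = F (g - ι (Finsupp.single i 1)) := by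
  rw [act_apply, MvPolynomial.support_X]
  simp

theorem act_mul (ι : (σ →₀ ℕ) →+ Γ) (p q : MvPolynomial σ ℂ) (F : Γ → W) :
    act ι (p * q) F = act ι p (act ι q F) := by
  rw [map_mul]; rfl

/-- Cancellation of nonzero polynomials on families admitting a leading term. -/
theorem act_cancel {Λ : Type*} [AddCommGroup Λ] [LinearOrder Λ] [IsOrderedAddMonoid Λ]
    (ι : (σ →₀ ℕ) →+ Γ) (hι : Function.Injective ι) (e : Γ →+ Λ) (he : Function.Injective e)
    {p : MvPolynomial σ ℂ} (hp : p ≠ 0) {F : Γ → W} (h : act ι p F = 0)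
    (hF : F ≠ 0 → ∃ g, F g ≠ 0 ∧ ∀ g', e g' < e g → F g' = 0) : F = 0 := by
  by_contra hne
  obtain ⟨g, hg, hmin⟩ := hF hne
  have hs : p.support.Nonempty := by
    rwa [Finset.nonempty_iff_ne_empty, Ne, MvPolynomial.support_eq_empty]
  obtain ⟨d, hd, hdmin⟩ := Finset.exists_min_image p.support (fun d => e (ι d)) hs
  have h1 := congrFun h (g + ι d)
  rw [act_apply, Finset.sum_eq_single d] at h1
  · rw [add_sub_cancel_right, Pi.zero_apply, smul_eq_zero] at h1
    exact h1.elim (fun h2 => MvPolynomial.mem_support_iff.1 hd h2) hg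
  · intro d' hd' hne'
    rw [hmin, smul_zero]
    have h2 : e (ι d) < e (ι d') :=
      lt_of_le_of_ne (hdmin d' hd') fun h3 => hne' (hι (he h3)).symm
    rw [map_sub, map_add]
    rw [sub_lt_iff_lt_add]
    exact add_lt_add_right h2 _
  · exact fun h2 => absurd hd h2

/-- Exponents of polynomials in two variables. -/
def exp2 : (Fin 2 →₀ ℕ) →+ ℤ × ℤ where
  toFun d := (d 0, d 1)
  map_zero' := by simp
  map_add' a b := by simp

/-- Exponents of polynomials in three variables. -/
def exp3 : (Fin 3 →₀ ℕ) →+ ℤ × ℤ × ℤ where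
  toFun d := (d 0, d 1, d 2)
  map_zero' := by simp
  map_add' a b := by simp

theorem exp2_injective : Function.Injective exp2 := by
  intro a b h
  simp only [exp2, AddMonoidHom.coe_mk, ZeroHom.coe_mk, Prod.mk.injEq, Nat.cast_inj] at h
  ext i
  fin_cases i
  · exact h.1
  · exact h.2

theorem exp3_injective : Function.Injective exp3 := by
  intro a b h
  simp only [exp3, AddMonoidHom.coe_mk, ZeroHom.coe_mk, Prod.mk.injEq, Nat.cast_inj] at h
  ext i
  fin_cases i
  · exact h.1
  · exact h.2.1
  · exact h.2.2

@[simp] theorem act2_X0 (F : ℤ × ℤ → W) (m t : ℤ) :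
    act exp2 (MvPolynomial.X 0) F (m, t) = F (m - 1, t) := by
  rw [act_X]; simp [exp2]

@[simp] theorem act2_X1 (F : ℤ × ℤ → W) (m t : ℤ) :
    act exp2 (MvPolynomial.X 1) F (m, t) = F (m, t - 1) := by
  rw [act_X]; simp [exp2]

@[simp] theorem act3_X0 (F : ℤ × ℤ × ℤ → W) (m n t : ℤ) :
    act exp3 (MvPolynomial.X 0) F (m, n, t) = F (m - 1, n, t) := by
  rw [act_X]; simp [exp3]

@[simp] theorem act3_X1 (F : ℤ × ℤ × ℤ → W) (m n t : ℤ) :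
    act exp3 (MvPolynomial.X 1) F (m, n, t) = F (m, n - 1, t) := by
  rw [act_X]; simp [exp3]

@[simp] theorem act3_X2 (F : ℤ × ℤ × ℤ → W) (m n t : ℤ) :
    act exp3 (MvPolynomial.X 2) F (m, n, t) = F (m, n, t - 1) := by
  rw [act_X]; simp [exp3]

/-- Families in `W((x))((y))`, indexed by the exponents of `y` and `x`. -/
def LL2 (F : ℤ × ℤ → W) : Prop :=
  (∃ N : ℤ, ∀ m t, m < N → F (m, t) = 0) ∧ ∀ m, ∃ N : ℤ, ∀ t, t < N → F (m, t) = 0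

/-- Families in `W((x))((y))((z))`, indexed by the exponents of `z`, `y` and `x`. -/
def LL3 (F : ℤ × ℤ × ℤ → W) : Prop :=
  (∃ N : ℤ, ∀ m g, m < N → F (m, g) = 0) ∧ ∀ m, LL2 fun g => F (m, g)

theorem exists_least_of_trunc {P : ℤ → Prop} (N : ℤ) (hN : ∀ m, m < N → ¬ P m)
    (hP : ∃ m, P m) : ∃ m, P m ∧ ∀ m', m' < m → ¬ P m' := by
  obtain ⟨m, hm, hmin⟩ := Int.exists_least_of_bdd (P := P)
    ⟨N, fun z hz => le_of_not_gt fun h => hN z h hz⟩ hP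
  exact ⟨m, hm, fun m' h h' => absurd (hmin m' h') (not_le.2 h)⟩

theorem LL2.exists_leading {F : ℤ × ℤ → W} (hF : LL2 F) (hne : F ≠ 0) :
    ∃ m t, F (m, t) ≠ 0 ∧ (∀ m' t', m' < m → F (m', t') = 0) ∧
      ∀ t', t' < t → F (m, t') = 0 := by
  obtain ⟨⟨N, hN⟩, h2⟩ := hF
  obtain ⟨g, hg⟩ := Function.ne_iff.1 hne
  obtain ⟨m, ⟨t, ht⟩, hm⟩ := exists_least_of_trunc (P := fun m => ∃ t, F (m, t) ≠ 0) N
    (fun m hm ⟨t, ht⟩ => ht (hN m t hm)) ⟨g.1, g.2, hg⟩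
  obtain ⟨M, hM⟩ := h2 m
  obtain ⟨t', ht', hm'⟩ := exists_least_of_trunc (P := fun t => F (m, t) ≠ 0) M
    (fun t h h' => h' (hM t h)) ⟨t, ht⟩
  refine ⟨m, t', ht', fun a b h => ?_, fun b h => ?_⟩
  · by_contra h'; exact hm a h ⟨b, h'⟩
  · by_contra h'; exact hm' b h h'

theorem LL2.cancel {p : MvPolynomial (Fin 2) ℂ} (hp : p ≠ 0) {F : ℤ × ℤ → W} (hF : LL2 F)
    (h : act exp2 p F = 0) : F = 0 := by
  refine act_cancel exp2 exp2_injective (toLexAddEquiv (ℤ × ℤ)).toAddMonoidHom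
    (toLexAddEquiv (ℤ × ℤ)).injective hp h fun hne => ?_
  obtain ⟨m, t, h1, h2, h3⟩ := hF.exists_leading hne
  refine ⟨(m, t), h1, ?_⟩
  rintro ⟨m', t'⟩ hlt
  rcases Prod.Lex.toLex_lt_toLex.1 hlt with h4 | ⟨h4, h5⟩
  · exact h2 _ _ h4
  · obtain rfl : m' = m := h4
    exact h3 _ h5

/-- The lexicographic reindexing of `ℤ × ℤ × ℤ`. -/
def lex3 : ℤ × ℤ × ℤ →+ ℤ ×ₗ (ℤ ×ₗ ℤ) where
  toFun g := toLex (g.1, toLex g.2)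
  map_zero' := rfl
  map_add' _ _ := rfl

theorem LL3.cancel {p : MvPolynomial (Fin 3) ℂ} (hp : p ≠ 0) {F : ℤ × ℤ × ℤ → W} (hF : LL3 F)
    (h : act exp3 p F = 0) : F = 0 := by
  refine act_cancel exp3 exp3_injective lex3 (fun a b hab => hab) hp h fun hne => ?_
  obtain ⟨⟨N, hN⟩, hF2⟩ := hF
  obtain ⟨g, hg⟩ := Function.ne_iff.1 hne
  obtain ⟨m, ⟨g', hg'⟩, hm⟩ := exists_least_of_trunc (P := fun m => ∃ t, F (m, t) ≠ 0) N
    (fun m hm ⟨t, ht⟩ => ht (hN m t hm)) ⟨g.1, g.2, hg⟩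
  obtain ⟨n, t, h1, h2, h3⟩ := (hF2 m).exists_leading (Function.ne_iff.2 ⟨g', hg'⟩)
  refine ⟨(m, n, t), h1, ?_⟩
  rintro ⟨m', n', t'⟩ hlt
  rcases Prod.Lex.toLex_lt_toLex.1 hlt with h4 | ⟨h4, h5⟩
  · by_contra h'; exact hm m' h4 ⟨_, h'⟩
  · obtain rfl : m' = m := h4
    rcases Prod.Lex.toLex_lt_toLex.1 h5 with h6 | ⟨h6, h7⟩
    · exact h2 _ _ h6
    · obtain rfl : n' = n := h6
      exact h3 _ h7

theorem LL2.add {F G : ℤ × ℤ → W} (hF : LL2 F) (hG : LL2 G) : LL2 (F + G) := by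
  obtain ⟨⟨N, hN⟩, hF⟩ := hF
  obtain ⟨⟨M, hM⟩, hG⟩ := hG
  refine ⟨⟨min N M, fun m t h => ?_⟩, fun m => ?_⟩
  · simp [hN m t (by omega), hM m t (by omega)]
  · obtain ⟨N', hN'⟩ := hF m
    obtain ⟨M', hM'⟩ := hG m
    exact ⟨min N' M', fun t h => by simp [hN' t (by omega), hM' t (by omega)]⟩

theorem LL2.smul {F : ℤ × ℤ → W} (c : ℂ) (hF : LL2 F) : LL2 (c • F) :=
  ⟨hF.1.imp fun _ h m t hm => by simp [h m t hm],
    fun m => (hF.2 m).imp fun _ h t ht => by simp [h t ht]⟩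

theorem LL2.X0 {F : ℤ × ℤ → W} (hF : LL2 F) : LL2 (act exp2 (MvPolynomial.X 0) F) := by
  refine ⟨?_, fun m => ?_⟩
  · obtain ⟨N, hN⟩ := hF.1
    exact ⟨N + 1, fun m t h => by rw [act2_X0, hN _ _ (by omega)]⟩
  · obtain ⟨N, hN⟩ := hF.2 (m - 1)
    exact ⟨N, fun t h => by rw [act2_X0, hN _ (by omega)]⟩

theorem LL2.X1 {F : ℤ × ℤ → W} (hF : LL2 F) : LL2 (act exp2 (MvPolynomial.X 1) F) := by
  refine ⟨?_, fun m => ?_⟩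
  · obtain ⟨N, hN⟩ := hF.1
    exact ⟨N, fun m t h => by rw [act2_X1, hN _ _ (by omega)]⟩
  · obtain ⟨N, hN⟩ := hF.2 m
    exact ⟨N + 1, fun t h => by rw [act2_X1, hN _ (by omega)]⟩

/-- `W((x))((y))` as a subspace. -/
def LL2sub (W : Type*) [AddCommGroup W] [Module ℂ W] : Submodule ℂ (ℤ × ℤ → W) where
  carrier := {F | LL2 F}
  add_mem' := LL2.add
  zero_mem' := ⟨⟨0, fun _ _ _ => rfl⟩, fun _ => ⟨0, fun _ _ => rfl⟩⟩
  smul_mem' c _ h := h.smul c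

theorem LL2.act {F : ℤ × ℤ → W} (hF : LL2 F) (p : MvPolynomial (Fin 2) ℂ) :
    LL2 (act exp2 p F) := by
  have := act_mem_of_generators (NVA.act exp2) (NVA.act exp2)
    ((LL2sub W).prod (⊤ : Submodule ℂ (ℤ × ℤ → W))) (fun i s g hs => ?_) p
    (s := F) (g := F) ⟨hF, trivial⟩
  · exact this.1
  · refine ⟨?_, trivial⟩
    fin_cases i
    · exact LL2.X0 hs.1
    · exact LL2.X1 hs.1

end Act

/-! ### Substitution of `x₀ + x₂` for `x₁` -/

theorem binom_zero (m : ℤ) : binom m 0 = 1 := by simp [binom]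

theorem binom_succ_succ (m : ℤ) (j : ℕ) :
    binom (m + 1) (j + 1) = binom m (j + 1) + binom m j := by
  unfold binom
  rw [Finset.prod_range_succ', Finset.prod_range_succ, Nat.factorial_succ]
  have h : ∀ i ∈ Finset.range j, (((m + 1 : ℤ) : ℂ) - ((i + 1 : ℕ) : ℂ)) = (m : ℂ) - (i : ℂ) := by
    intro i _; push_cast; ring
  rw [Finset.prod_congr rfl h]
  have h1 : (j.factorial : ℂ) ≠ 0 := Nat.cast_ne_zero.2 j.factorial_ne_zero
  have h2 : ((j : ℂ) + 1) ≠ 0 := by exact_mod_cast Nat.succ_ne_zero j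
  push_cast
  field_simp
  ring

theorem binom_natCast (n j : ℕ) : binom (n : ℤ) j = (n.choose j : ℂ) := by
  induction n generalizing j with
  | zero =>
    cases j with
    | zero => simp [binom]
    | succ j => simp [binom, Finset.prod_range_succ']
  | succ n ih =>
    cases j with
    | zero => simp [binom]
    | succ j =>
      rw [Nat.cast_succ, binom_succ_succ, ih, ih, Nat.choose_succ_succ]
      push_cast; ring

section Subst

variable {W : Type*} [AddCommGroup W] [Module ℂ W]

/-- Two-variable families whose powers of the second variable are bounded below. -/
def TruncSnd (S : ℤ × ℤ → W) : Prop := ∃ N : ℤ, ∀ m t, t < N → S (m, t) = 0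

/-- The family `S(x₀ + x₂, x₂)`, expanded in nonnegative powers of `x₂`. -/
def subst (S : ℤ × ℤ → W) : ℤ × ℤ → W :=
  fun g => ∑ᶠ i : ℕ, binom (g.1 + i) i • S (g.1 + i, g.2 - i)

theorem subst_eq_sum {S : ℤ × ℤ → W} {N : ℤ} (hS : ∀ m t, t < N → S (m, t) = 0) (a b : ℤ)
    {M : ℕ} (hM : b - M < N) :
    subst S (a, b) = ∑ i ∈ Finset.range M, binom (a + i) i • S (a + i, b - i) := by
  refine finsum_eq_sum_of_support_subset _ fun i hi => ?_
  rw [Finset.coe_range, Set.mem_Iio]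
  by_contra h
  refine hi ?_
  show binom (a + i) i • S (a + i, b - i) = 0
  rw [hS _ _ (by omega), smul_zero]

theorem exists_nat_sub_lt (b N : ℤ) : ∃ M : ℕ, b - M < N := ⟨(b - N + 1).toNat, by omega⟩

/-- The graph of `subst` on its natural domain. -/
def substGraph (W : Type*) [AddCommGroup W] [Module ℂ W] :
    Submodule ℂ ((ℤ × ℤ → W) × (ℤ × ℤ → W)) where
  carrier := {P | TruncSnd P.1 ∧ P.2 = subst P.1}
  add_mem' := by
    rintro ⟨S, G⟩ ⟨S', G'⟩ ⟨⟨N, hN⟩, h⟩ ⟨⟨N', hN'⟩, h'⟩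
    dsimp only at hN hN'
    have h1 : ∀ m t, t < min N N' → (S + S') (m, t) = 0 := fun m t ht => by
      rw [Pi.add_apply, hN _ _ (by omega), hN' _ _ (by omega), add_zero]
    refine ⟨⟨_, h1⟩, ?_⟩
    funext ⟨a, b⟩
    obtain ⟨M, hM⟩ := exists_nat_sub_lt b (min N N')
    dsimp only at h h' ⊢
    simp only [Prod.mk_add_mk]
    rw [subst_eq_sum h1 a b hM, h, h', Pi.add_apply, subst_eq_sum hN a b (M := M) (by omega),
      subst_eq_sum hN' a b (M := M) (by omega), ← Finset.sum_add_distrib]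
    simp
  zero_mem' := by
    refine ⟨⟨0, fun _ _ _ => rfl⟩, ?_⟩
    funext g
    simp [subst]
  smul_mem' := by
    rintro c ⟨S, G⟩ ⟨⟨N, hN⟩, h⟩
    dsimp only at hN
    have h1 : ∀ m t, t < N → (c • S) (m, t) = 0 := fun m t ht => by
      rw [Pi.smul_apply, hN _ _ ht, smul_zero]
    refine ⟨⟨_, h1⟩, ?_⟩
    funext ⟨a, b⟩
    obtain ⟨M, hM⟩ := exists_nat_sub_lt b N
    dsimp only at h ⊢
    simp only [Prod.smul_mk]
    rw [subst_eq_sum h1 a b hM, h, Pi.smul_apply, subst_eq_sum hN a b hM, Finset.smul_sum]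
    exact Finset.sum_congr rfl fun i _ => by rw [Pi.smul_apply, smul_comm]

theorem TruncSnd.X0 {S : ℤ × ℤ → W} (hS : TruncSnd S) :
    TruncSnd (act exp2 (MvPolynomial.X 0) S) :=
  hS.imp fun _ h m t ht => by rw [act2_X0, h _ _ ht]

theorem TruncSnd.X1 {S : ℤ × ℤ → W} (hS : TruncSnd S) :
    TruncSnd (act exp2 (MvPolynomial.X 1) S) := by
  obtain ⟨N, hN⟩ := hS
  exact ⟨N + 1, fun m t ht => by rw [act2_X1, hN _ _ (by omega)]⟩

theorem subst_X0 {S : ℤ × ℤ → W} (hS : TruncSnd S) :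
    subst (act exp2 (MvPolynomial.X 0) S) =
      act exp2 (MvPolynomial.X 0 + MvPolynomial.X 1) (subst S) := by
  obtain ⟨N, hN⟩ := hS
  funext ⟨a, b⟩
  obtain ⟨M, hM⟩ := exists_nat_sub_lt b N
  rw [map_add, LinearMap.add_apply, Pi.add_apply, act2_X0, act2_X1,
    subst_eq_sum (N := N) (fun m t ht => by rw [act2_X0, hN _ _ ht]) a b (M := M + 1)
      (by push_cast; omega),
    subst_eq_sum hN (a - 1) b (M := M + 1) (by push_cast; omega),
    subst_eq_sum hN a (b - 1) (M := M) (by omega), Finset.sum_range_succ', Finset.sum_range_succ']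
  simp only [act2_X0, Nat.cast_zero, binom_zero, add_zero]
  rw [add_right_comm, ← Finset.sum_add_distrib]
  congr 1
  refine Finset.sum_congr rfl fun i _ => ?_
  have h1 : a + ((i + 1 : ℕ) : ℤ) = a + i + 1 := by push_cast; ring
  have h2 : a - 1 + ((i + 1 : ℕ) : ℤ) = a + i := by push_cast; ring
  have h3 : b - ((i + 1 : ℕ) : ℤ) = b - 1 - i := by push_cast; ring
  rw [h1, h2, h3, binom_succ_succ, add_smul, add_sub_cancel_right]

theorem subst_X1 {S : ℤ × ℤ → W} (hS : TruncSnd S) :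
    subst (act exp2 (MvPolynomial.X 1) S) = act exp2 (MvPolynomial.X 1) (subst S) := by
  obtain ⟨N, hN⟩ := hS
  funext ⟨a, b⟩
  rw [act2_X1]
  unfold subst
  refine finsum_congr fun i => ?_
  dsimp only
  rw [act2_X1, sub_right_comm]

/-- The polynomial `p(x₀ + x₂, x₂)`. -/
def hat : MvPolynomial (Fin 2) ℂ →ₐ[ℂ] MvPolynomial (Fin 2) ℂ :=
  MvPolynomial.aeval ![MvPolynomial.X 0 + MvPolynomial.X 1, MvPolynomial.X 1]

@[simp] theorem hat_X0 :
    hat (MvPolynomial.X 0) = MvPolynomial.X 0 + MvPolynomial.X 1 := by simp [hat]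

@[simp] theorem hat_X1 : hat (MvPolynomial.X 1) = MvPolynomial.X 1 := by simp [hat]

theorem hat_ne_zero {p : MvPolynomial (Fin 2) ℂ} (hp : p ≠ 0) : hat p ≠ 0 := by
  intro h
  refine hp ?_
  have h1 : (MvPolynomial.aeval ![MvPolynomial.X 0 - MvPolynomial.X 1,
      (MvPolynomial.X 1 : MvPolynomial (Fin 2) ℂ)]).comp hat = AlgHom.id ℂ _ := by
    ext i
    fin_cases i <;> simp
  simpa [h] using (DFunLike.congr_fun h1 p).symm

theorem subst_mem_act {S G : ℤ × ℤ → W} (h : (S, G) ∈ substGraph W)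
    (p : MvPolynomial (Fin 2) ℂ) : (act exp2 p S, act exp2 (hat p) G) ∈ substGraph W := by
  refine act_mem_of_generators (act exp2) ((act exp2).comp hat) (substGraph W) ?_ p h
  rintro i S G ⟨hS, hG : G = subst S⟩
  rw [hG]
  fin_cases i
  · refine ⟨hS.X0, ?_⟩
    simp only [Fin.zero_eta, AlgHom.comp_apply, hat_X0]
    exact (subst_X0 hS).symm
  · refine ⟨hS.X1, ?_⟩
    simp only [Fin.mk_one, AlgHom.comp_apply, hat_X1]
    exact (subst_X1 hS).symm

theorem TruncSnd.act {S : ℤ × ℤ → W} (hS : TruncSnd S) (p : MvPolynomial (Fin 2) ℂ) :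
    TruncSnd (act exp2 p S) :=
  (subst_mem_act (S := S) (G := subst S) ⟨hS, rfl⟩ p).1

theorem subst_act {S : ℤ × ℤ → W} (hS : TruncSnd S) (p : MvPolynomial (Fin 2) ℂ) :
    subst (NVA.act exp2 p S) = NVA.act exp2 (hat p) (subst S) :=
  (subst_mem_act (S := S) (G := subst S) ⟨hS, rfl⟩ p).2.symm

/-! ### Families in `W[[x₁]]((x₂))` -/

/-- Families in `W[[x₁]]((x₂))`. -/
def Reg (S : ℤ × ℤ → W) : Prop := ∃ N : ℤ, ∀ m t, (m < 0 ∨ t < N) → S (m, t) = 0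

theorem Reg.truncSnd {S : ℤ × ℤ → W} (hS : Reg S) : TruncSnd S :=
  hS.imp fun _ h m t ht => h m t (.inr ht)

/-- `W[[x₁]]((x₂))` as a subspace. -/
def regSub (W : Type*) [AddCommGroup W] [Module ℂ W] : Submodule ℂ (ℤ × ℤ → W) where
  carrier := {F | Reg F}
  add_mem' := by
    rintro S S' ⟨N, hN⟩ ⟨N', hN'⟩
    exact ⟨min N N', fun m t h => by
      rw [Pi.add_apply, hN _ _ (by omega), hN' _ _ (by omega), add_zero]⟩
  zero_mem' := ⟨0, fun _ _ _ => rfl⟩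
  smul_mem' c _ h := h.imp fun _ h m t ht => by rw [Pi.smul_apply, h m t ht, smul_zero]

theorem Reg.act {S : ℤ × ℤ → W} (hS : Reg S) (p : MvPolynomial (Fin 2) ℂ) :
    Reg (act exp2 p S) := by
  refine (act_mem_of_generators (NVA.act exp2) (NVA.act exp2)
    ((regSub W).prod (⊤ : Submodule ℂ (ℤ × ℤ → W))) (fun i s g hs => ?_) p
    (s := S) (g := S) ⟨hS, trivial⟩).1
  refine ⟨?_, trivial⟩
  obtain ⟨N, hN⟩ := hs.1
  fin_cases i
  · exact ⟨N, fun m t h => by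
      simp only [Fin.zero_eta, act2_X0]; exact hN _ _ (by omega)⟩
  · exact ⟨N + 1, fun m t h => by
      simp only [Fin.mk_one, act2_X1]; exact hN _ _ (by omega)⟩

/-- The coefficient of `x₀^a` in `(x₀ + 1)^m` for `m, a ≥ 0`. -/
def chi (m : ℕ) (a : ℤ) : ℂ := if 0 ≤ a then (m.choose a.toNat : ℂ) else 0

theorem subst_eq_chi_sum {S : ℤ × ℤ → W} {N : ℤ} (hS : ∀ m t, (m < 0 ∨ t < N) → S (m, t) = 0)
    (a b : ℤ) {B : ℕ} (hB : a + b - B < N) :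
    subst S (a, b) = ∑ m ∈ Finset.range B, chi m a • S (m, a + b - m) := by
  rcases lt_or_ge a 0 with ha | ha
  · rw [Finset.sum_eq_zero fun m _ => by rw [chi, if_neg (by omega), zero_smul]]
    refine finsum_eq_zero_of_forall_eq_zero fun i => ?_
    dsimp only
    rcases lt_or_ge (a + i) 0 with h | h
    · rw [hS _ _ (.inl h), smul_zero]
    · obtain ⟨n, hn⟩ := Int.eq_ofNat_of_zero_le h
      rw [hn, binom_natCast, Nat.choose_eq_zero_of_lt (by omega), Nat.cast_zero, zero_smul]
  · obtain ⟨n, rfl⟩ := Int.eq_ofNat_of_zero_le ha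
    have hB' : ∑ m ∈ Finset.range B, chi m n • S (m, n + b - m) =
        ∑ m ∈ Finset.range (n + B), chi m n • S (m, n + b - m) := by
      refine Finset.sum_subset (Finset.range_mono (Nat.le_add_left B n)) fun m _ hm => ?_
      rw [Finset.mem_range] at hm
      rw [hS _ _ (.inr (by omega)), smul_zero]
    rw [hB', Finset.sum_range_add,
      Finset.sum_eq_zero, zero_add, subst_eq_sum (fun m t h => hS m t (.inr h)) (n : ℤ) b (M := B)]
    · refine Finset.sum_congr rfl fun i _ => ?_
      rw [← Nat.cast_add, binom_natCast, chi, if_pos ha, Int.toNat_natCast,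
        Nat.choose_symm_add]
      congr 3
      push_cast; ring
    · omega
    · intro m hm
      rw [chi, if_pos ha, Int.toNat_natCast,
        Nat.choose_eq_zero_of_lt (by simpa using hm), Nat.cast_zero, zero_smul]

theorem Reg.LL2_subst {S : ℤ × ℤ → W} (hS : Reg S) : LL2 (subst S) := by
  obtain ⟨N, hN⟩ := hS
  refine ⟨⟨0, fun a b ha => ?_⟩, fun a => ⟨N - a, fun b hb => ?_⟩⟩
  · obtain ⟨B, hB⟩ := exists_nat_sub_lt (a + b) N
    rw [subst_eq_chi_sum hN a b hB]
    exact Finset.sum_eq_zero fun m _ => by rw [chi, if_neg (by omega), zero_smul]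
  · rw [subst_eq_chi_sum hN a b (B := 0) (by push_cast; omega)]
    rfl

end Subst

theorem chi_of_neg (m : ℕ) {a : ℤ} (ha : a < 0) : chi m a = 0 := if_neg (by omega)

theorem chi_natCast (m a : ℕ) : chi m (a : ℤ) = (m.choose a : ℂ) := by
  rw [chi, if_pos (Int.natCast_nonneg a), Int.toNat_natCast]

theorem sum_chi_mul_chi (a d j : ℕ) (b : ℤ) {B : ℕ} (hB : a + b < B) :
    ∑ m ∈ Finset.range B, chi m a * chi (a + d) m * chi j (a + b - m) =
      chi (a + d) a * chi (d + j) b := by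
  rcases lt_or_ge b 0 with hb | hb
  · rw [chi_of_neg _ hb, mul_zero]
    refine Finset.sum_eq_zero fun m _ => ?_
    rcases lt_or_ge m a with h | h
    · rw [chi_natCast, Nat.choose_eq_zero_of_lt h, Nat.cast_zero, zero_mul, zero_mul]
    · rw [chi_of_neg j (by omega), mul_zero]
  · obtain ⟨b, rfl⟩ := Int.eq_ofNat_of_zero_le hb
    obtain ⟨e, rfl⟩ : ∃ e, B = a + (b + 1) + e := ⟨B - (a + (b + 1)), by omega⟩
    rw [Finset.sum_range_add, Finset.sum_range_add, Finset.sum_eq_zero (s := Finset.range a),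
      Finset.sum_eq_zero (s := Finset.range e), zero_add, add_zero]
    · have h : ∀ k ∈ Finset.range (b + 1),
          chi (a + k) a * chi (a + d) (a + k : ℕ) * chi j (a + b - (a + k : ℕ)) =
            ((a + d).choose a : ℂ) * ((d.choose k * j.choose (b - k) : ℕ) : ℂ) := by
        intro k hk
        have hk' : k ≤ b := by simpa [Nat.lt_succ_iff] using hk
        have h1 : (a : ℤ) + b - (a + k : ℕ) = ((b - k : ℕ) : ℤ) := by omega
        rw [h1, chi_natCast, chi_natCast, chi_natCast]
        have h2 : (a + d).choose (a + k) * (a + k).choose a = (a + d).choose a * d.choose k := by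
          rw [Nat.choose_mul (Nat.le_add_right a k)]
          simp
        have h3 : (((a + d).choose (a + k) : ℕ) : ℂ) * ((a + k).choose a : ℕ) =
            ((a + d).choose a : ℕ) * (d.choose k : ℕ) := by exact_mod_cast h2
        rw [mul_comm ((a + k).choose a : ℂ), h3]
        push_cast; ring
      rw [Finset.sum_congr rfl h, ← Finset.mul_sum, ← Nat.cast_sum, chi_natCast, chi_natCast,
        Nat.add_choose_eq d j b, Finset.Nat.sum_antidiagonal_eq_sum_range_succ_mk]
    · intro k _
      rw [chi_of_neg j (by push_cast; omega), mul_zero]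
    · intro m hm
      rw [chi_natCast, Nat.choose_eq_zero_of_lt (by simpa using hm), Nat.cast_zero, zero_mul,
        zero_mul]

section Triple

variable {W : Type*} [AddCommGroup W] [Module ℂ W]

theorem subst_of_fst_neg {S : ℤ × ℤ → W} (hS : Reg S) {a : ℤ} (ha : a < 0) (b : ℤ) :
    subst S (a, b) = 0 := by
  obtain ⟨N, hN⟩ := hS
  obtain ⟨B, hB⟩ := exists_nat_sub_lt (a + b) N
  rw [subst_eq_chi_sum hN a b hB]
  exact Finset.sum_eq_zero fun m _ => by rw [chi_of_neg _ ha, zero_smul]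

theorem subst_of_snd_lt {S : ℤ × ℤ → W} {N : ℤ} (hS : ∀ m t, t < N → S (m, t) = 0) (a : ℤ)
    {b : ℤ} (hb : b < N) : subst S (a, b) = 0 := by
  rw [subst_eq_sum hS a b (M := 0) (by push_cast; omega)]
  rfl

theorem subst_of_add_lt {S : ℤ × ℤ → W} {N : ℤ} (hS : ∀ m t, (m < 0 ∨ t < N) → S (m, t) = 0)
    {a b : ℤ} (hb : a + b < N) : subst S (a, b) = 0 := by
  rw [subst_eq_chi_sum hS a b (B := 0) (by push_cast; omega)]
  rfl

/-- Substituting `x₁ = x + z`, `x₂ = x + y` and then `z + y` for `z` agrees with substituting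
`x₁ = x₂ + z` and then `x₂ = x + y`. -/
theorem subst_subst_subst {H : ℤ × ℤ × ℤ → W} {N : ℤ}
    (hH : ∀ m n t, (m < 0 ∨ n < 0 ∨ t < N) → H (m, n, t) = 0) (a b t : ℤ) :
    subst (fun g => subst (fun k => subst (fun l => H (k.1, l)) (g.2, k.2)) (g.1, t)) (a, b) =
      subst (fun g => subst (fun k => H (k.1, k.2, g.2)) (a, g.1)) (b, t) := by
  have r1 : ∀ m : ℤ, ∀ n t, (n < 0 ∨ t < N) → (fun l => H (m, l)) (n, t) = 0 :=
    fun m n t h => hH m n t (.inr h)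
  have r2 : ∀ n : ℤ, ∀ m t, (m < 0 ∨ t < N - n) →
      (fun k : ℤ × ℤ => subst (fun l => H (k.1, l)) (n, k.2)) (m, t) = 0 := by
    rintro n m t (h | h)
    · exact finsum_eq_zero_of_forall_eq_zero fun i => by
        dsimp only; rw [hH _ _ _ (.inl h), smul_zero]
    · exact subst_of_add_lt (r1 m) (by omega)
  have r3 : ∀ m n, (m < 0 ∨ n < 0) → (fun g : ℤ × ℤ =>
      subst (fun k => subst (fun l => H (k.1, l)) (g.2, k.2)) (g.1, t)) (m, n) = 0 := by
    rintro m n (h | h)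
    · exact subst_of_fst_neg ⟨_, r2 n⟩ h t
    · refine finsum_eq_zero_of_forall_eq_zero fun i => ?_
      dsimp only
      rw [subst_of_fst_neg ⟨_, r1 _⟩ h, smul_zero]
  have r4 : ∀ t : ℤ, ∀ m n, (m < 0 ∨ n < 0) → (fun k : ℤ × ℤ => H (k.1, k.2, t)) (m, n) = 0 :=
    fun t m n h => hH m n t (by omega)
  have r5 : ∀ n t, (n < 0 ∨ t < N) →
      (fun g : ℤ × ℤ => subst (fun k => H (k.1, k.2, g.2)) (a, g.1)) (n, t) = 0 := by
    rintro n t (h | h)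
    · exact subst_of_snd_lt (fun m n hn => r4 t m n (.inr hn)) a h
    · exact finsum_eq_zero_of_forall_eq_zero fun i => by
        dsimp only; rw [hH _ _ _ (.inr (.inr h)), smul_zero]
  rcases lt_or_ge a 0 with ha | ha
  · rw [subst_of_fst_neg ⟨0, r3⟩ ha]
    symm
    refine finsum_eq_zero_of_forall_eq_zero fun i => ?_
    dsimp only
    rw [subst_of_fst_neg ⟨0, r4 _⟩ ha, smul_zero]
  obtain ⟨a, rfl⟩ := Int.eq_ofNat_of_zero_le ha
  obtain ⟨B, hB1, hB2, hB3⟩ : ∃ B : ℕ, a + b + t - B < N ∧ b + t - B < N ∧ a + b < B :=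
    ⟨(max (max (a + b + t - N) (b + t - N)) (a + b) + 1).toNat, by omega, by omega, by omega⟩
  have e1 : ∀ m ∈ Finset.range B, chi m a • subst (fun k => subst (fun l => H (k.1, l))
      (a + b - m, k.2)) (m, t) = ∑ i ∈ Finset.range (a + B), ∑ j ∈ Finset.range B,
        (chi m a * chi i m * chi j (a + b - m)) • H (i, j, a + b + t - i - j) := by
    intro m _
    rw [subst_eq_chi_sum (r2 _) m t (B := a + B) (by push_cast; omega), Finset.smul_sum]
    refine Finset.sum_congr rfl fun i _ => ?_
    dsimp only
    rw [subst_eq_chi_sum (r1 _) _ _ (B := B) (by omega), Finset.smul_sum, Finset.smul_sum]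
    refine Finset.sum_congr rfl fun j _ => ?_
    rw [smul_smul, smul_smul, mul_assoc]
    congr 4
    ring
  have e2 : ∀ n ∈ Finset.range B, chi n b • subst (fun k => H (k.1, k.2, b + t - n)) (a, n) =
      ∑ i ∈ Finset.range (a + B), (chi n b * chi i a) • H (i, a + n - i, b + t - n) := by
    intro n hn
    have hn' : n < B := by simpa using hn
    rw [subst_eq_chi_sum (r4 _) _ _ (B := a + B) (by push_cast; omega), Finset.smul_sum]
    exact Finset.sum_congr rfl fun i _ => smul_smul _ _ _
  rw [subst_eq_chi_sum r3 a b (B := B) (by omega), subst_eq_chi_sum r5 b t (B := B) (by omega)]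
  rw [Finset.sum_congr rfl e1, Finset.sum_congr rfl e2, Finset.sum_comm,
    Finset.sum_comm (s := Finset.range B)]
  refine Finset.sum_congr rfl fun i _ => ?_
  rw [Finset.sum_comm]
  simp_rw [← Finset.sum_smul]
  rcases lt_or_ge i a with hi | hi
  · rw [Finset.sum_eq_zero, Finset.sum_eq_zero]
    · intro n _
      rw [chi_natCast i a, Nat.choose_eq_zero_of_lt hi, Nat.cast_zero, mul_zero, zero_smul]
    · intro j _
      rw [Finset.sum_eq_zero, zero_smul]
      intro m _
      rw [chi_natCast, chi_natCast]
      rcases lt_or_ge m a with h | h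
      · rw [Nat.choose_eq_zero_of_lt h, Nat.cast_zero, zero_mul, zero_mul]
      · rw [Nat.choose_eq_zero_of_lt (hi.trans_le h), Nat.cast_zero, mul_zero, zero_mul]
  · obtain ⟨d, rfl⟩ := Nat.exists_eq_add_of_le hi
    have e3 : ∑ n ∈ Finset.range B, (chi n b * chi (a + d) a) •
        H ((a + d : ℕ), a + n - (a + d : ℕ), b + t - n) = ∑ n ∈ Finset.range (d + B),
        (chi n b * chi (a + d) a) • H ((a + d : ℕ), a + n - (a + d : ℕ), b + t - n) := by
      refine Finset.sum_subset (Finset.range_mono (Nat.le_add_left B d)) fun n _ hn => ?_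
      rw [Finset.mem_range] at hn
      rw [hH _ _ _ (.inr (.inr (by omega))), smul_zero]
    rw [e3, Finset.sum_range_add, Finset.sum_eq_zero (s := Finset.range d), zero_add]
    · refine Finset.sum_congr rfl fun j _ => ?_
      rw [sum_chi_mul_chi a d j b hB3, mul_comm]
      congr 4
      · push_cast; ring
      · push_cast; ring
    · intro n hn
      rw [hH _ _ _ (.inr (.inl (by have := Finset.mem_range.1 hn; push_cast; omega))), smul_zero]

end Triple

/-! ### Substitution up to a polynomial factor -/

section SubstRel

variable {W : Type*} [AddCommGroup W] [Module ℂ W]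

/-- `G(y, x)` is the expansion of `S(x + y, x)` in `W((x))((y))`, in the sense that this holds
after multiplication by a nonzero polynomial making `S` regular. -/
def SubstEq (S G : ℤ × ℤ → W) : Prop :=
  LL2 G ∧ ∃ p : MvPolynomial (Fin 2) ℂ, p ≠ 0 ∧ Reg (act exp2 p S) ∧
    act exp2 (hat p) G = subst (act exp2 p S)

theorem act_hat_mul {S G : ℤ × ℤ → W} {p : MvPolynomial (Fin 2) ℂ}
    (h1 : TruncSnd (act exp2 p S)) (h2 : act exp2 (hat p) G = subst (act exp2 p S))
    (q : MvPolynomial (Fin 2) ℂ) :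
    act exp2 (hat (q * p)) G = subst (act exp2 (q * p) S) := by
  rw [map_mul, act_mul, act_mul, h2, subst_act h1]

/-- The linear relation given by `SubstEq`. -/
def substRel (W : Type*) [AddCommGroup W] [Module ℂ W] :
    Submodule ℂ ((ℤ × ℤ → W) × (ℤ × ℤ → W)) where
  carrier := {P | SubstEq P.1 P.2}
  add_mem' := by
    rintro ⟨S, G⟩ ⟨S', G'⟩ ⟨hG, p, hp, hr, he⟩ ⟨hG', p', hp', hr', he'⟩
    dsimp only at *
    have hr1 : Reg (act exp2 (p' * p) S) := by rw [act_mul]; exact hr.act p'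
    have hr2 : Reg (act exp2 (p' * p) S') := by rw [mul_comm, act_mul]; exact hr'.act p
    have he1 := act_hat_mul hr.truncSnd he p'
    have he2 := act_hat_mul hr'.truncSnd he' p
    rw [mul_comm] at he2
    refine ⟨hG.add hG', p' * p, mul_ne_zero hp' hp, ?_, ?_⟩
    · simp only [Prod.mk_add_mk, map_add]
      exact (regSub W).add_mem hr1 hr2
    · simp only [Prod.mk_add_mk, map_add]
      exact ((substGraph W).add_mem (x := (_, _)) (y := (_, _)) ⟨hr1.truncSnd, he1⟩
        ⟨hr2.truncSnd, he2⟩).2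
  zero_mem' := by
    refine ⟨(LL2sub W).zero_mem, 1, one_ne_zero, ?_, ?_⟩
    · simp only [Prod.fst_zero, map_zero]
      exact (regSub W).zero_mem
    · simp only [Prod.fst_zero, Prod.snd_zero, map_zero]
      exact (substGraph W).zero_mem.2
  smul_mem' := by
    rintro c ⟨S, G⟩ ⟨hG, p, hp, hr, he⟩
    dsimp only at *
    refine ⟨hG.smul c, p, hp, ?_, ?_⟩
    · simp only [Prod.smul_mk, map_smul]
      exact (regSub W).smul_mem c hr
    · simp only [Prod.smul_mk, map_smul]
      exact ((substGraph W).smul_mem c (x := (_, _)) ⟨hr.truncSnd, he⟩).2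

theorem mem_substRel {S G : ℤ × ℤ → W} : (S, G) ∈ substRel W ↔ SubstEq S G := Iff.rfl

theorem SubstEq.unique {S G G' : ℤ × ℤ → W} (h : SubstEq S G) (h' : SubstEq S G') : G = G' := by
  have h1 : SubstEq (S - S) (G - G') := (substRel W).sub_mem (x := (S, G)) (y := (S, G')) h h'
  obtain ⟨hG, p, hp, -, he⟩ := h1
  have h0 : subst (0 : ℤ × ℤ → W) = 0 := (substGraph W).zero_mem.2.symm
  rw [sub_self, map_zero, h0] at he
  exact sub_eq_zero.1 (hG.cancel (hat_ne_zero hp) he)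

theorem SubstEq.act {S G : ℤ × ℤ → W} (h : SubstEq S G) (q : MvPolynomial (Fin 2) ℂ) :
    SubstEq (act exp2 q S) (NVA.act exp2 (hat q) G) := by
  obtain ⟨hG, p, hp, hr, he⟩ := h
  refine ⟨hG.act _, p, hp, ?_, ?_⟩
  · rw [← act_mul, mul_comm, act_mul]
    exact hr.act q
  · rw [← act_mul, ← act_mul, ← map_mul, mul_comm, act_hat_mul hr.truncSnd he]

theorem Reg.substEq {S : ℤ × ℤ → W} (h : Reg S) : SubstEq S (subst S) := by
  refine ⟨h.LL2_subst, 1, one_ne_zero, ?_, ?_⟩ <;> simp only [map_one, Module.End.one_apply]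
  exact h

theorem SubstEq.eq_subst {S G : ℤ × ℤ → W} (h : SubstEq S G) (hS : Reg S) : G = subst S :=
  h.unique hS.substEq

/-- If `S(x₀ + x₂, x₂)` makes sense then it agrees with its `SubstEq` expansion after
multiplication by a polynomial. -/
theorem SubstEq.exists_act_eq {S G : ℤ × ℤ → W} (h : SubstEq S G) (hS : TruncSnd S) :
    ∃ p : MvPolynomial (Fin 2) ℂ, p ≠ 0 ∧
      NVA.act exp2 (hat p) (subst S) = NVA.act exp2 (hat p) G := by
  obtain ⟨-, p, hp, -, he⟩ := h
  exact ⟨p, hp, by rw [he, subst_act hS]⟩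

section Map

variable {W' : Type*} [AddCommGroup W'] [Module ℂ W']

theorem act_map {Γ σ : Type*} [AddCommGroup Γ] (ι : (σ →₀ ℕ) →+ Γ) (p : MvPolynomial σ ℂ)
    (L : W →ₗ[ℂ] W') (S : Γ → W) : NVA.act ι p (fun g => L (S g)) = fun g => L (NVA.act ι p S g) := by
  funext g
  rw [act_apply, act_apply, map_sum]
  simp only [map_smul]

theorem subst_map {S : ℤ × ℤ → W} (hS : TruncSnd S) (L : W →ₗ[ℂ] W') :
    subst (fun g => L (S g)) = fun g => L (subst S g) := by
  obtain ⟨N, hN⟩ := hS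
  funext ⟨a, b⟩
  obtain ⟨M, hM⟩ := exists_nat_sub_lt b N
  rw [subst_eq_sum hN a b hM, subst_eq_sum (S := fun g => L (S g))
    (fun m t h => by rw [hN m t h, map_zero]) a b hM, map_sum]
  simp only [map_smul]

theorem SubstEq.map {S G : ℤ × ℤ → W} (h : SubstEq S G) (L : W →ₗ[ℂ] W') :
    SubstEq (fun g => L (S g)) (fun g => L (G g)) := by
  obtain ⟨hG, p, hp, ⟨N, hN⟩, he⟩ := h
  refine ⟨⟨hG.1.imp fun _ h m t hm => by dsimp only; rw [h m t hm, map_zero],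
    fun m => (hG.2 m).imp fun _ h t ht => by dsimp only; rw [h t ht, map_zero]⟩, p, hp, ?_, ?_⟩
  · rw [act_map]
    exact ⟨N, fun m t h => by dsimp only; rw [hN m t h, map_zero]⟩
  · rw [act_map, act_map, subst_map ⟨N, fun m t h => hN m t (.inr h)⟩, he]

end Map

/-! ### Substitution in `W((x₁, x₂))` -/

/-- Families in `W((x₁, x₂))`. -/
def Laurent2 (S : ℤ × ℤ → W) : Prop := ∃ N : ℤ, ∀ m t, (m < N ∨ t < N) → S (m, t) = 0

/-- The coefficient of `x₀^j x^t` in `S(x + x₀, x)`, expanded in nonnegative powers of `x₀`. -/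
def substIn (S : ℤ × ℤ → W) : ℤ × ℤ → W := fun g =>
  if 0 ≤ g.1 then ∑ᶠ m : ℤ, binom m g.1.toNat • S (m, g.2 - m + g.1) else 0

theorem substIn_summand_support {S : ℤ × ℤ → W} {N : ℤ}
    (hN : ∀ m t, (m < N ∨ t < N) → S (m, t) = 0) (c : ℤ → ℂ) (t : ℤ) :
    (Function.support fun m : ℤ => c m • S (m, t - m)) ⊆ Finset.Icc N (t - N) := by
  intro m hm
  rw [Finset.coe_Icc, Set.mem_Icc]
  by_contra h
  refine hm ?_
  dsimp only
  rw [hN _ _ (by omega), smul_zero]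

theorem substIn_natCast {S : ℤ × ℤ → W} {N : ℤ} (hN : ∀ m t, (m < N ∨ t < N) → S (m, t) = 0)
    (j : ℕ) (t : ℤ) : substIn S (j, t) =
      ∑ m ∈ Finset.Icc N (t + j - N), binom m j • S (m, t + j - m) := by
  rw [← finsum_eq_sum_of_support_subset _ (substIn_summand_support hN _ _), substIn,
    if_pos (Int.natCast_nonneg j)]
  refine finsum_congr fun m => ?_
  dsimp only
  rw [Int.toNat_natCast, add_sub_right_comm]

theorem substIn_of_neg (S : ℤ × ℤ → W) {j : ℤ} (hj : j < 0) (t : ℤ) : substIn S (j, t) = 0 :=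
  if_neg (by omega)

theorem Laurent2.LL2_substIn {S : ℤ × ℤ → W} (hS : Laurent2 S) : LL2 (substIn S) := by
  obtain ⟨N, hN⟩ := hS
  refine ⟨⟨0, fun j t hj => substIn_of_neg S hj t⟩, fun j => ?_⟩
  rcases lt_or_ge j 0 with hj | hj
  · exact ⟨0, fun t _ => substIn_of_neg S hj t⟩
  · obtain ⟨j, rfl⟩ := Int.eq_ofNat_of_zero_le hj
    refine ⟨2 * N - j, fun t ht => ?_⟩
    rw [substIn_natCast hN, Finset.Icc_eq_empty (by omega), Finset.sum_empty]

theorem Laurent2.X0 {S : ℤ × ℤ → W} (hS : Laurent2 S) :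
    Laurent2 (act exp2 (MvPolynomial.X 0) S) := by
  obtain ⟨N, hN⟩ := hS
  exact ⟨N, fun m t h => by rw [act2_X0, hN _ _ (by omega)]⟩

theorem substIn_X0 {S : ℤ × ℤ → W} (hS : Laurent2 S) :
    substIn (act exp2 (MvPolynomial.X 0) S) =
      act exp2 (MvPolynomial.X 0 + MvPolynomial.X 1) (substIn S) := by
  obtain ⟨N, hN⟩ := hS
  have hN' : ∀ m t, (m < N ∨ t < N) → act exp2 (MvPolynomial.X 0) S (m, t) = 0 :=
    fun m t h => by rw [act2_X0, hN _ _ (by omega)]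
  funext ⟨a, t⟩
  rw [map_add, LinearMap.add_apply, Pi.add_apply, act2_X0, act2_X1]
  rcases lt_or_ge a 0 with ha | ha
  · rw [substIn_of_neg _ ha, substIn_of_neg _ ha, substIn_of_neg _ (by omega), add_zero]
  obtain ⟨j, rfl⟩ := Int.eq_ofNat_of_zero_le ha
  have e1 : substIn (act exp2 (MvPolynomial.X 0) S) (j, t) =
      ∑ᶠ m : ℤ, binom (m + 1) j • S (m, t + j - 1 - m) := by
    rw [substIn, if_pos (Int.natCast_nonneg j)]
    refine finsum_eq_of_bijective (fun m : ℤ => m - 1) (Equiv.subRight (1 : ℤ)).bijective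
      fun m => ?_
    dsimp only
    rw [act2_X0, Int.toNat_natCast, sub_add_cancel]
    congr 3
    ring
  rw [e1, finsum_eq_sum_of_support_subset _ (substIn_summand_support hN _ _),
    substIn_natCast hN j (t - 1)]
  cases j with
  | zero =>
    rw [substIn_of_neg _ (by simp), zero_add]
    simp only [binom_zero, Nat.cast_zero, add_zero]
  | succ j =>
    have h1 : ((j + 1 : ℕ) : ℤ) - 1 = j := by push_cast; ring
    have h2 : t + ((j + 1 : ℕ) : ℤ) - 1 = t + j := by push_cast; ring
    have h3 : t - 1 + ((j + 1 : ℕ) : ℤ) = t + j := by push_cast; ring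
    rw [h1, h2, h3, substIn_natCast hN j t, ← Finset.sum_add_distrib]
    refine Finset.sum_congr rfl fun m _ => ?_
    rw [binom_succ_succ, add_smul, add_comm]

theorem substIn_X0_pow {S : ℤ × ℤ → W} (hS : Laurent2 S) (k : ℕ) :
    Laurent2 (act exp2 (MvPolynomial.X 0 ^ k) S) ∧
    substIn (act exp2 (MvPolynomial.X 0 ^ k) S) =
      act exp2 (hat (MvPolynomial.X 0 ^ k)) (substIn S) := by
  induction k with
  | zero => simpa using hS
  | succ k ih =>
    rw [pow_succ', act_mul, map_mul, act_mul, substIn_X0 ih.1, hat_X0, ih.2]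
    exact ⟨ih.1.X0, rfl⟩

theorem Reg.substIn_eq {S : ℤ × ℤ → W} (hS : Reg S) : substIn S = subst S := by
  obtain ⟨N, hN⟩ := hS
  have hN' : ∀ m t, (m < min N 0 ∨ t < min N 0) → S (m, t) = 0 :=
    fun m t h => hN m t (by omega)
  funext ⟨a, t⟩
  rcases lt_or_ge a 0 with ha | ha
  · rw [substIn_of_neg _ ha, subst_of_fst_neg ⟨N, hN⟩ ha]
  obtain ⟨j, rfl⟩ := Int.eq_ofNat_of_zero_le ha
  obtain ⟨B, hB⟩ := exists_nat_sub_lt (j + t) N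
  rw [subst_eq_chi_sum hN j t hB, substIn, if_pos ha, finsum_eq_sum_of_support_subset
    (s := (Finset.range B).map Nat.castEmbedding), Finset.sum_map]
  · refine Finset.sum_congr rfl fun m _ => ?_
    rw [Nat.castEmbedding_apply, chi_natCast, binom_natCast, Int.toNat_natCast]
    congr 3
    ring
  · intro m hm
    by_contra h
    refine hm ?_
    dsimp only
    have h1 : m < 0 ∨ t - m + j < N := by
      by_contra h2
      refine h ?_
      rw [Finset.coe_map, Set.mem_image]
      exact ⟨m.toNat, by simp only [Finset.coe_range, Set.mem_Iio]; omega, by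
        rw [Nat.castEmbedding_apply]; omega⟩
    rw [hN _ _ h1, smul_zero]

theorem Laurent2.exists_reg {S : ℤ × ℤ → W} (hS : Laurent2 S) :
    ∃ k : ℕ, Reg (act exp2 (MvPolynomial.X 0 ^ k) S) := by
  obtain ⟨N, hN⟩ := hS
  have h : ∀ k : ℕ, ∀ m t : ℤ, act exp2 (MvPolynomial.X 0 ^ k) S (m, t) = S (m - k, t) := by
    intro k
    induction k with
    | zero => intro m t; simp
    | succ k ih =>
      intro m t
      rw [pow_succ', act_mul, act2_X0, ih]
      congr 2; push_cast; ring
  exact ⟨(-N).toNat, N, fun m t hm => by rw [h, hN _ _ (by omega)]⟩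

theorem SubstEq.of_laurent2 {S G : ℤ × ℤ → W} (hG : LL2 G) {p : MvPolynomial (Fin 2) ℂ}
    (hp : p ≠ 0) (hS : Laurent2 (NVA.act exp2 p S))
    (h : NVA.act exp2 (hat p) G = substIn (NVA.act exp2 p S)) : SubstEq S G := by
  obtain ⟨k, hk⟩ := hS.exists_reg
  refine ⟨hG, MvPolynomial.X 0 ^ k * p,
    mul_ne_zero (pow_ne_zero _ (MvPolynomial.X_ne_zero 0)) hp, ?_, ?_⟩
  · rwa [act_mul]
  · rw [map_mul, act_mul, h, ← (substIn_X0_pow hS k).2, hk.substIn_eq, act_mul]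

theorem Laurent2.substEq {S : ℤ × ℤ → W} (hS : Laurent2 S) : SubstEq S (substIn S) :=
  .of_laurent2 hS.LL2_substIn one_ne_zero (by simpa using hS) (by simp)

end SubstRel

/-! ### Arithmetic in `ℂ((x))((x₀))` -/

/-- The field structure on `ℂ((x))((x₀))`. -/
abbrev fieldK2 : Field K2 := inferInstance

/-- Multiplication in `ℂ((x))((x₀))`. -/
def mulK (a b : K2) : K2 := fieldK2.mul a b

theorem mulK_assoc (a b c : K2) : mulK (mulK a b) c = mulK a (mulK b c) := fieldK2.mul_assoc a b c

theorem add_mulK (a b c : K2) : mulK (a + b) c = mulK a c + mulK b c :=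
  fieldK2.right_distrib a b c

theorem zero_mulK (a : K2) : mulK 0 a = 0 := fieldK2.zero_mul a

theorem mulK_qInv {p : MvPolynomial (Fin 2) ℂ} (h : qK p 1 ≠ 0) : mulK (qK p 1) (qInv p 1) = 1 :=
  fieldK2.mul_inv_cancel _ h

theorem qK_add (p q : MvPolynomial (Fin 2) ℂ) (α : ℂ) : qK (p + q) α = qK p α + qK q α :=
  map_add (MvPolynomial.aeval _) p q

theorem qK_mul (p q : MvPolynomial (Fin 2) ℂ) (α : ℂ) : qK (p * q) α = mulK (qK p α) (qK q α) :=
  map_mul (MvPolynomial.aeval _) p q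

theorem qK_X0 (α : ℂ) : qK (MvPolynomial.X 0) α = xOuter + xInnerC α := MvPolynomial.aeval_X _ _

theorem qK_X1 (α : ℂ) : qK (MvPolynomial.X 1) α = xInner := MvPolynomial.aeval_X _ _

theorem qK_C (c α : ℂ) :
    qK (MvPolynomial.C c) α = HahnSeries.single 0 (HahnSeries.single 0 c) := by
  have h : qK (MvPolynomial.C c) α = algebraMap ℂ K2 c := MvPolynomial.aeval_C _ _
  have h' : algebraMap ℂ LC c = HahnSeries.single 0 c := by
    refine (HahnSeries.algebraMap_apply' ..).trans ?_
    rw [PowerSeries.algebraMap_apply]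
    exact HahnSeries.ofPowerSeries_C ..
  rw [h, ← h']
  refine (HahnSeries.algebraMap_apply' ..).trans ?_
  rw [PowerSeries.algebraMap_apply]
  exact HahnSeries.ofPowerSeries_C ..

theorem coeff_single_mulK (n : ℤ) (c : LC) (k : K2) (s : ℤ) :
    (mulK (HahnSeries.single n c) k).coeff s = c * k.coeff (s - n) :=
  HahnSeries.coeff_single_mul

theorem coeff_single_mulLC (n : ℤ) (c : ℂ) (x : LC) (t : ℤ) :
    (HahnSeries.single n c * x).coeff t = c * x.coeff (t - n) :=
  HahnSeries.coeff_single_mul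

theorem coeff_xOuter_mulK (k : K2) (s : ℤ) : (mulK xOuter k).coeff s = k.coeff (s - 1) :=
  (coeff_single_mulK 1 1 k s).trans (one_mul _)

theorem coeff_xInner_mulK (k : K2) (s t : ℤ) :
    ((mulK xInner k).coeff s).coeff t = (k.coeff s).coeff (t - 1) := by
  rw [xInner, coeff_single_mulK, coeff_single_mulLC, one_mul, sub_zero]

theorem coeff_qK_C_mulK (c α : ℂ) (k : K2) (s t : ℤ) :
    ((mulK (qK (MvPolynomial.C c) α) k).coeff s).coeff t = c * (k.coeff s).coeff t := by
  rw [qK_C, coeff_single_mulK, coeff_single_mulLC, sub_zero, sub_zero]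

/-! ### Multiplication of families by iterated Laurent series -/

section Conv

variable {W : Type*} [AddCommGroup W] [Module ℂ W]

/-- Multiplication of a family by an element of `ℂ((x))((x₀))`. -/
def conv (k : K2) (S : ℤ × ℤ → W) : ℤ × ℤ → W :=
  fun g => ∑ᶠ s : ℤ × ℤ, (k.coeff s.1).coeff s.2 • S (g.1 - s.1, g.2 - s.2)

theorem exists_coeff_eq_zero_of_lt {R : Type*} [Zero R] (x : HahnSeries ℤ R) :
    ∃ N : ℤ, ∀ n, n < N → x.coeff n = 0 :=
  ⟨x.order, fun _ h => HahnSeries.coeff_eq_zero_of_lt_order h⟩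

theorem exists_int_lower_bound (a b : ℤ) (f : ℤ → ℤ) :
    ∃ M : ℤ, ∀ i, a ≤ i → i ≤ b → M ≤ f i := by
  obtain ⟨M, hM⟩ := ((Finset.Icc a b).image f).bddBelow
  exact ⟨M, fun i h1 h2 => hM (Finset.mem_image_of_mem f (Finset.mem_Icc.2 ⟨h1, h2⟩))⟩

theorem conv_summand_bound (k : K2) {S : ℤ × ℤ → W} (hS : LL2 S) (J : ℤ) :
    ∃ A B C : ℤ, ∀ T s₁ s₂, (k.coeff s₁).coeff s₂ • S (J - s₁, T - s₂) ≠ 0 →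
      A ≤ s₁ ∧ s₁ ≤ B ∧ C ≤ s₂ ∧ s₂ ≤ T - C := by
  obtain ⟨⟨N, hN⟩, hS2⟩ := hS
  obtain ⟨A, hA⟩ := exists_coeff_eq_zero_of_lt k
  choose f hf using fun i => exists_coeff_eq_zero_of_lt (k.coeff i)
  choose g hg using hS2
  obtain ⟨C, hC⟩ := exists_int_lower_bound A (J - N) f
  obtain ⟨D, hD⟩ := exists_int_lower_bound A (J - N) fun i => g (J - i)
  refine ⟨A, J - N, min C D, fun T s₁ s₂ h => ?_⟩
  have h1 : A ≤ s₁ := by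
    by_contra h'
    rw [hA _ (by omega), HahnSeries.coeff_zero, zero_smul] at h
    exact h rfl
  have h2 : s₁ ≤ J - N := by
    by_contra h'
    rw [hN _ _ (by omega), smul_zero] at h
    exact h rfl
  have h3 : f s₁ ≤ s₂ := by
    by_contra h'
    rw [hf _ _ (by omega), zero_smul] at h
    exact h rfl
  have h4 : g (J - s₁) ≤ T - s₂ := by
    by_contra h'
    rw [hg _ _ (by omega), smul_zero] at h
    exact h rfl
  have := hC _ h1 h2
  have := hD _ h1 h2
  omega

theorem conv_finite_support (k : K2) {S : ℤ × ℤ → W} (hS : LL2 S) (g : ℤ × ℤ) :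
    (Function.support fun s : ℤ × ℤ =>
      (k.coeff s.1).coeff s.2 • S (g.1 - s.1, g.2 - s.2)).Finite := by
  obtain ⟨A, B, C, h⟩ := conv_summand_bound k hS g.1
  refine ((Set.finite_Icc A B).prod (Set.finite_Icc C (g.2 - C))).subset fun s hs => ?_
  obtain ⟨h1, h2, h3, h4⟩ := h g.2 s.1 s.2 hs
  exact ⟨⟨h1, h2⟩, h3, h4⟩

theorem LL2.conv (k : K2) {S : ℤ × ℤ → W} (hS : LL2 S) : LL2 (conv k S) := by
  have h0 := hS
  obtain ⟨⟨N, hN⟩, -⟩ := hS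
  obtain ⟨A, hA⟩ := exists_coeff_eq_zero_of_lt k
  refine ⟨⟨A + N, fun J T h => finsum_eq_zero_of_forall_eq_zero fun s => ?_⟩, fun J => ?_⟩
  · dsimp only
    rcases lt_or_ge s.1 A with h1 | h1
    · rw [hA _ h1, HahnSeries.coeff_zero, zero_smul]
    · rw [hN _ _ (by omega), smul_zero]
  · obtain ⟨A, B, C, h⟩ := conv_summand_bound k h0 J
    refine ⟨2 * C, fun T hT => finsum_eq_zero_of_forall_eq_zero fun s => ?_⟩
    by_contra h'
    have := h T s.1 s.2 h'
    omega

theorem conv_add (k k' : K2) {S : ℤ × ℤ → W} (hS : LL2 S) :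
    conv (k + k') S = conv k S + conv k' S := by
  funext g
  rw [Pi.add_apply, conv, conv, conv,
    ← finsum_add_distrib (conv_finite_support k hS g) (conv_finite_support k' hS g)]
  refine finsum_congr fun s => ?_
  rw [← add_smul]
  rfl

theorem conv_zero (S : ℤ × ℤ → W) : conv 0 S = 0 :=
  funext fun _ => finsum_eq_zero_of_forall_eq_zero fun _ => zero_smul ℂ _

theorem conv_qK_C_mulK (c α : ℂ) (k : K2) {S : ℤ × ℤ → W} (hS : LL2 S) :
    conv (mulK (qK (MvPolynomial.C c) α) k) S = c • conv k S := by
  funext g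
  rw [Pi.smul_apply, conv, conv, smul_finsum' c (conv_finite_support k hS g)]
  refine finsum_congr fun s => ?_
  rw [coeff_qK_C_mulK, mul_smul]

theorem conv_one (S : ℤ × ℤ → W) : conv 1 S = S := by
  funext g
  rw [conv, finsum_eq_single _ (0 : ℤ × ℤ)]
  · show (((1 : K2).coeff 0).coeff 0) • S (g.1 - 0, g.2 - 0) = S g
    rw [HahnSeries.coeff_one, if_pos rfl, HahnSeries.coeff_one, if_pos rfl, one_smul, sub_zero,
      sub_zero]
  · rintro ⟨s₁, s₂⟩ h
    dsimp only
    by_cases h1 : s₁ = 0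
    · subst h1
      have h2 : s₂ ≠ 0 := fun h2 => h (by rw [h2]; rfl)
      rw [HahnSeries.coeff_one, if_pos rfl, HahnSeries.coeff_one, if_neg h2, zero_smul]
    · rw [HahnSeries.coeff_one, if_neg h1, HahnSeries.coeff_zero, zero_smul]

theorem conv_xOuter_mulK (k : K2) (S : ℤ × ℤ → W) :
    conv (mulK xOuter k) S = act exp2 (MvPolynomial.X 0) (conv k S) := by
  funext ⟨J, T⟩
  rw [act2_X0]
  refine finsum_eq_of_bijective (fun s : ℤ × ℤ => (s.1 - 1, s.2))
    ((Equiv.subRight (1 : ℤ)).prodCongr (Equiv.refl ℤ)).bijective fun s => ?_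
  dsimp only
  rw [coeff_xOuter_mulK, sub_sub_sub_cancel_right]

theorem conv_xInner_mulK (k : K2) (S : ℤ × ℤ → W) :
    conv (mulK xInner k) S = act exp2 (MvPolynomial.X 1) (conv k S) := by
  funext ⟨J, T⟩
  rw [act2_X1]
  refine finsum_eq_of_bijective (fun s : ℤ × ℤ => (s.1, s.2 - 1))
    ((Equiv.refl ℤ).prodCongr (Equiv.subRight (1 : ℤ))).bijective fun s => ?_
  dsimp only
  rw [coeff_xInner_mulK, sub_sub_sub_cancel_right]

theorem conv_qK_mulK (p : MvPolynomial (Fin 2) ℂ) (k : K2) {S : ℤ × ℤ → W} (hS : LL2 S) :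
    conv (mulK (qK p 1) k) S = act exp2 (hat p) (conv k S) := by
  induction p using MvPolynomial.induction_on generalizing k with
  | C c =>
    have h : hat (MvPolynomial.C c) = MvPolynomial.C c := MvPolynomial.aeval_C _ _
    rw [conv_qK_C_mulK c 1 k hS, h, ← MvPolynomial.algebraMap_eq, AlgHom.commutes]
    rfl
  | add p q hp hq =>
    rw [qK_add, add_mulK, conv_add _ _ hS, hp, hq, map_add, map_add, LinearMap.add_apply]
  | mul_X p i hp =>
    rw [qK_mul, mulK_assoc, hp, map_mul, act_mul]
    fin_cases i
    · simp only [Fin.zero_eta, qK_X0, hat_X0, map_add, LinearMap.add_apply]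
      rw [add_mulK, conv_add _ _ hS, conv_xOuter_mulK, map_add]
      exact congrArg _ (congrArg _ (conv_xInner_mulK k S))
    · simp only [Fin.mk_one, qK_X1, hat_X1]
      rw [conv_xInner_mulK]

theorem qK_ne_zero {p : MvPolynomial (Fin 2) ℂ} (hp : p ≠ 0) : qK p 1 ≠ 0 := by
  intro h
  have hS : LL2 (fun g : ℤ × ℤ => if g = 0 then (1 : ℂ) else 0) := by
    refine ⟨⟨0, fun m t h => if_neg fun h' => ?_⟩, fun m => ⟨0, fun t h => if_neg fun h' => ?_⟩⟩
    · rw [Prod.mk_eq_zero] at h'; omega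
    · rw [Prod.mk_eq_zero] at h'; omega
  have h1 := conv_qK_mulK p 1 hS
  rw [h, zero_mulK, conv_one, conv_zero] at h1
  have h2 := congrFun (hS.cancel (hat_ne_zero hp) h1.symm) 0
  simp at h2

theorem act_hat_conv_qInv {p : MvPolynomial (Fin 2) ℂ} (hp : p ≠ 0) {S : ℤ × ℤ → W}
    (hS : LL2 S) : act exp2 (hat p) (conv (qInv p 1) S) = S := by
  rw [← conv_qK_mulK p _ hS, mulK_qInv (qK_ne_zero hp), conv_one]

end Conv

/-! ### The products on `ℰ(W)` -/

section Products

variable {W : Type*} [AddCommGroup W] [Module ℂ W]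

@[simp] theorem mf_add_apply (a b : EW W) (w : W) (n : ℤ) :
    mf (a + b) w n = mf a w n + mf b w n := rfl

@[simp] theorem mf_smul_apply (c : ℂ) (a : EW W) (w : W) (n : ℤ) :
    mf (c • a) w n = c • mf a w n := rfl

@[simp] theorem mf_zero_apply (w : W) (n : ℤ) : mf (0 : EW W) w n = 0 := rfl

@[simp] theorem mf_oneE (w : W) (n : ℤ) : mf (oneE : EW W) w n = if n = -1 then w else 0 := rfl

theorem mf_ext {a b : EW W} (h : ∀ w n, mf a w n = mf b w n) : a = b :=
  Subtype.ext (LinearMap.ext fun w => funext fun n => h w n)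

/-- A mode of an element of `ℰ(W)`, as a linear map. -/
def modeMap (a : EW W) (n : ℤ) : W →ₗ[ℂ] W := (LinearMap.proj n).comp (a : W →ₗ[ℂ] (ℤ → W))

theorem modeMap_apply (a : EW W) (n : ℤ) (w : W) : modeMap a n w = mf a w n := rfl

/-- The modes at a vector, as a linear map on `ℰ(W)`. -/
def modeAt (w : W) (n : ℤ) : EW W →ₗ[ℂ] W where
  toFun a := mf a w n
  map_add' _ _ := rfl
  map_smul' _ _ := rfl

theorem modeAt_apply (a : EW W) (n : ℤ) (w : W) : modeAt w n a = mf a w n := rfl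

theorem mf_trunc (a : EW W) (w : W) : ∃ N : ℤ, ∀ t, t < N → mf a w (-t - 1) = 0 := by
  obtain ⟨N, hN⟩ := a.2 w
  exact ⟨-N, fun t ht => hN _ (by omega)⟩

/-- The coefficients of `a(x₁) b(x₂) w`. -/
def prodFam (a b : EW W) (w : W) : ℤ × ℤ → W := fun g => Fab a b w g.1 g.2

theorem prodFam_apply (a b : EW W) (w : W) (m t : ℤ) :
    prodFam a b w (m, t) = modeMap a (-m - 1) (modeMap b (-t - 1) w) := rfl

theorem prodFam_truncSnd (a b : EW W) (w : W) : TruncSnd (prodFam a b w) := by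
  obtain ⟨N, hN⟩ := mf_trunc b w
  exact ⟨N, fun m t h => by rw [prodFam_apply, modeMap_apply b, hN _ h, map_zero]⟩

/-- The coefficients of `Y_ℰ(a, x₀) b` at `w`. -/
def prodE (a b : EW W) (w : W) : ℤ × ℤ → W := fun g => mf (YE a b (-g.1 - 1)) w (-g.2 - 1)

theorem mulPoly_eq_act (p : MvPolynomial (Fin 2) ℂ) (F : ℤ → ℤ → W) (m t : ℤ) :
    mulPoly p F m t = act exp2 p (fun g => F g.1 g.2) (m, t) := by
  rw [act_apply]; rfl

theorem fullYE_eq_conv (p : MvPolynomial (Fin 2) ℂ) (a b : EW W) (w : W) (J T : ℤ) :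
    fullYE 1 p a b w J T = conv (qInv p 1) (substIn (act exp2 p (prodFam a b w))) (J, T) := by
  refine finsum_congr fun s => ?_
  dsimp only
  congr 1
  unfold substIn
  dsimp only
  split_ifs with h
  · refine finsum_congr fun m => ?_
    rw [one_zpow, mul_one, mulPoly_eq_act, Int.toNat_of_nonneg h]
    rfl
  · rfl

theorem QCPair.exists_laurent2 {a b : EW W} (h : QCPair a b) :
    h.choose ≠ 0 ∧ ∀ w, Laurent2 (act exp2 h.choose (prodFam a b w)) := by
  refine ⟨h.choose_spec.1, fun w => ?_⟩
  obtain ⟨N, hN⟩ := h.choose_spec.2 w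
  exact ⟨N, fun m t hmt => by rw [← hN m t hmt, mulPoly_eq_act]; rfl⟩

theorem QCPair.substEq_raw {a b : EW W} (h : QCPair a b) (w : W) :
    SubstEq (prodFam a b w) fun g => rawYE 1 a b (-g.1 - 1) w (-g.2 - 1) := by
  obtain ⟨hp, hL⟩ := h.exists_laurent2
  have h1 : (fun g : ℤ × ℤ => rawYE 1 a b (-g.1 - 1) w (-g.2 - 1)) =
      conv (qInv h.choose 1) (substIn (act exp2 h.choose (prodFam a b w))) := by
    funext ⟨J, T⟩
    rw [rawYE, dif_pos h, fullYE_eq_conv]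
    congr 2 <;> ring
  rw [h1]
  exact .of_laurent2 ((hL w).LL2_substIn.conv _) hp (hL w)
    (act_hat_conv_qInv hp (hL w).LL2_substIn)

theorem QCPair.exists_eq_raw {a b : EW W} (h : QCPair a b) (n : ℤ) :
    ∃ c : EW W, ∀ w m, mf c w m = rawYE 1 a b n w m := by
  have e : ∀ w m, rawYE 1 a b n w m =
      (fun g : ℤ × ℤ => rawYE 1 a b (-g.1 - 1) w (-g.2 - 1)) (-n - 1, -m - 1) := by
    intro w m
    dsimp only
    congr 1 <;> ring
  have h1 : ∀ w w', (fun g : ℤ × ℤ => rawYE 1 a b (-g.1 - 1) (w + w') (-g.2 - 1)) =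
      (fun g : ℤ × ℤ => rawYE 1 a b (-g.1 - 1) w (-g.2 - 1)) +
      (fun g : ℤ × ℤ => rawYE 1 a b (-g.1 - 1) w' (-g.2 - 1)) := by
    intro w w'
    refine (h.substEq_raw (w + w')).unique ?_
    have := (substRel W).add_mem (x := (_, _)) (y := (_, _)) (h.substEq_raw w) (h.substEq_raw w')
    convert! mem_substRel.1 this using 1
    funext ⟨m, t⟩
    simp only [prodFam_apply, map_add, Pi.add_apply]
    rfl
  have h2 : ∀ (c : ℂ) w, (fun g : ℤ × ℤ => rawYE 1 a b (-g.1 - 1) (c • w) (-g.2 - 1)) =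
      c • (fun g : ℤ × ℤ => rawYE 1 a b (-g.1 - 1) w (-g.2 - 1)) := by
    intro c w
    refine (h.substEq_raw (c • w)).unique ?_
    have := (substRel W).smul_mem c (x := (_, _)) (h.substEq_raw w)
    convert! mem_substRel.1 this using 1
    funext ⟨m, t⟩
    simp only [prodFam_apply, map_smul, Pi.smul_apply]
    rfl
  refine ⟨⟨⟨⟨fun w m => rawYE 1 a b n w m, fun w w' => ?_⟩, fun c w => ?_⟩, fun w => ?_⟩,
    fun w m => rfl⟩
  · funext m
    rw [Pi.add_apply, e, h1, e w, e w']
    rfl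
  · funext m
    show rawYE 1 a b n (c • w) m = c • rawYE 1 a b n w m
    rw [e, h2, e w]
    rfl
  · obtain ⟨N, hN⟩ := (h.substEq_raw w).1.2 (-n - 1)
    refine ⟨-N, fun m hm => ?_⟩
    show rawYE 1 a b n w m = 0
    rw [e]
    exact hN _ (by omega)

theorem QCPair.substEq {a b : EW W} (h : QCPair a b) (w : W) :
    SubstEq (prodFam a b w) (prodE a b w) := by
  have h1 : prodE a b w = fun g => rawYE 1 a b (-g.1 - 1) w (-g.2 - 1) := by
    funext g
    have h2 : ∃ c : EW W, ∀ w m, mf c w m = rawYE ((1 : ℂˣ) : ℂ) a b (-g.1 - 1) w m := by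
      rw [Units.val_one]
      exact h.exists_eq_raw _
    rw [prodE, YE, YEa, dif_pos h2, h2.choose_spec, Units.val_one]
  rw [h1]
  exact h.substEq_raw w

theorem YE_eq_of_prodE {a b : EW W} {c : ℤ → EW W}
    (h : ∀ w, prodE a b w = fun g => mf (c (-g.1 - 1)) w (-g.2 - 1)) (n : ℤ) :
    YE a b n = c n := by
  refine mf_ext fun w m => ?_
  have := congrFun (h w) (-n - 1, -m - 1)
  simpa only [prodE, sub_neg_eq_add, neg_sub, sub_sub_cancel_left, neg_neg, sub_add_cancel,
    add_sub_cancel_left, neg_add_cancel_left] using this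

/-- The product `Y_ℰ(a, x₀) b` is characterized by its defining relation. -/
theorem YE_eq_of_substEq {a b : EW W} (hab : QCPair a b) {c : ℤ → EW W}
    (h : ∀ w, SubstEq (prodFam a b w) fun g => mf (c (-g.1 - 1)) w (-g.2 - 1)) (n : ℤ) :
    YE a b n = c n :=
  YE_eq_of_prodE (fun w => (hab.substEq w).unique (h w)) n

theorem YE_add_left {a a' b : EW W} (h : QCPair a b) (h' : QCPair a' b)
    (h'' : QCPair (a + a') b) (n : ℤ) : YE (a + a') b n = YE a b n + YE a' b n :=
  YE_eq_of_substEq h'' (c := fun n => YE a b n + YE a' b n)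
    (fun w => (substRel W).add_mem (x := (_, _)) (y := (_, _)) (h.substEq w) (h'.substEq w)) n

theorem YE_smul_left (c : ℂ) {a b : EW W} (h : QCPair a b)
    (h'' : QCPair (c • a) b) (n : ℤ) : YE (c • a) b n = c • YE a b n :=
  YE_eq_of_substEq h'' (c := fun n => c • YE a b n)
    (fun w => (substRel W).smul_mem c (x := (_, _)) (h.substEq w)) n

theorem YE_oneE_left {b : EW W} (h : QCPair oneE b) (n : ℤ) :
    YE oneE b n = if n = -1 then b else 0 := by
  refine YE_eq_of_substEq h (c := fun n => if n = -1 then b else 0) (fun w => ?_) n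
  obtain ⟨N, hN⟩ := mf_trunc b w
  have hF : ∀ m t, prodFam oneE b w (m, t) = if m = 0 then mf b w (-t - 1) else 0 := by
    intro m t
    rw [prodFam_apply, modeMap_apply, mf_oneE]
    congr 1
    exact propext ⟨fun h => by omega, fun h => by omega⟩
  have hR : Reg (prodFam oneE b w) := by
    refine ⟨N, fun m t h => ?_⟩
    rw [hF]
    split_ifs with h0
    · exact hN t (by omega)
    · rfl
  convert! hR.substEq using 1
  funext ⟨m, t⟩
  rw [subst, finsum_eq_single _ 0]
  · dsimp only
    rw [Nat.cast_zero, add_zero, sub_zero, binom_zero, one_smul, hF]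
    split_ifs with h1 h2 h2
    · rfl
    · omega
    · omega
    · rfl
  · intro i hi
    dsimp only
    rw [hF]
    split_ifs with h1
    · have h2 : binom (m + i) i = 0 := by
        rw [h1]
        have := binom_natCast 0 i
        rw [Nat.choose_eq_zero_of_lt (by omega)] at this
        simpa using this
      rw [h2, zero_smul]
    · rw [smul_zero]

theorem YE_oneE_right {a : EW W} (h : QCPair a oneE) : YE a oneE (-1) = a := by
  refine mf_ext fun w n => ?_
  obtain ⟨N, hN⟩ := mf_trunc a w
  have hF : ∀ m t, prodFam a oneE w (m, t) = if t = 0 then mf a w (-m - 1) else 0 := by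
    intro m t
    rw [prodFam_apply, modeMap_apply oneE, mf_oneE, apply_ite (modeMap a (-m - 1)), map_zero]
    congr 1
    exact propext ⟨fun h => by omega, fun h => by omega⟩
  have hR : Laurent2 (prodFam a oneE w) := by
    refine ⟨min N 0, fun m t h => ?_⟩
    rw [hF]
    split_ifs with h0
    · exact hN _ (by omega)
    · rfl
  have h1 := congrFun ((h.substEq w).unique hR.substEq) (0, -n - 1)
  have h2 : substIn (prodFam a oneE w) (0, -n - 1) = mf a w n := by
    rw [substIn, if_pos le_rfl, finsum_eq_single _ (-n - 1)]
    · dsimp only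
      rw [hF, if_pos (by ring), Int.toNat_zero, binom_zero, one_smul]
      congr 1; ring
    · intro m hm
      dsimp only
      rw [hF, if_neg (by omega), smul_zero]
  rw [h2] at h1
  rw [← h1, prodE]
  congr 1
  dsimp only; ring

/-- Elements of a quasi compatible set form quasi compatible pairs. -/
theorem QCSet.qcPair {S : Set (EW W)} (hS : QCSet S) {a b : EW W} (ha : a ∈ S) (hb : b ∈ S) :
    QCPair a b := by
  obtain ⟨p, hp, h⟩ := hS 2 ![a, b] fun i => by fin_cases i <;> assumption
  have hP : pairPoly p 2 = p := by
    have h1 : Finset.univ.filter (fun ij : Fin 2 × Fin 2 => ij.1 < ij.2) = {(0, 1)} := by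
      decide
    have h2 : (![0, 1] : Fin 2 → Fin 2) = id := by
      funext i; fin_cases i <;> rfl
    rw [pairPoly, h1, Finset.prod_singleton, h2, MvPolynomial.rename_id_apply]
  rw [hP] at h
  refine ⟨p, hp, fun w => ?_⟩
  obtain ⟨N, hN⟩ := h w
  refine ⟨N, fun m t hmt => ?_⟩
  rw [← hN ![m, t]]
  · rfl
  · rcases hmt with h | h
    · exact ⟨0, h⟩
    · exact ⟨1, h⟩

end Products

/-! ### Three variables -/

section ThreeVariables

variable {W : Type*} [AddCommGroup W] [Module ℂ W]

/-- Substitution in the last two variables. -/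
def SubstEqSnd (S G : ℤ × ℤ × ℤ → W) : Prop :=
  ∀ u, SubstEq (fun g => S (u, g)) fun g => G (u, g)

/-- The polynomial `p(x₀, x₁ + x₂, x₂)`. -/
def hatSnd : MvPolynomial (Fin 3) ℂ →ₐ[ℂ] MvPolynomial (Fin 3) ℂ :=
  MvPolynomial.aeval
    ![MvPolynomial.X 0, MvPolynomial.X 1 + MvPolynomial.X 2, MvPolynomial.X 2]

/-- The polynomial `p(x₀ + x₁, x₁, x₂)`. -/
def hatFst : MvPolynomial (Fin 3) ℂ →ₐ[ℂ] MvPolynomial (Fin 3) ℂ :=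
  MvPolynomial.aeval
    ![MvPolynomial.X 0 + MvPolynomial.X 1, MvPolynomial.X 1, MvPolynomial.X 2]

theorem SubstEqSnd.act {S G : ℤ × ℤ × ℤ → W} (h : SubstEqSnd S G) (r : MvPolynomial (Fin 3) ℂ) :
    SubstEqSnd (act exp3 r S) (act exp3 (hatSnd r) G) := by
  let R : Submodule ℂ ((ℤ × ℤ × ℤ → W) × (ℤ × ℤ × ℤ → W)) :=
    { carrier := {P | SubstEqSnd P.1 P.2}
      add_mem' := fun {P Q} hP hQ u =>
        (substRel W).add_mem (x := (_, _)) (y := (_, _)) (hP u) (hQ u)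
      zero_mem' := fun u => (substRel W).zero_mem
      smul_mem' := fun c {P} hP u => (substRel W).smul_mem c (x := (_, _)) (hP u) }
  refine act_mem_of_generators (NVA.act exp3) ((NVA.act exp3).comp hatSnd) R
    (fun i S G h => ?_) r (s := S) (g := G) h
  replace h : SubstEqSnd S G := h
  show SubstEqSnd _ _
  intro u
  fin_cases i
  · convert h (u - 1) using 1
    · funext ⟨n, t⟩
      simp
    · funext ⟨n, t⟩
      simp [hatSnd]
  · convert (h u).act (MvPolynomial.X 0) using 1
    · funext ⟨n, t⟩
      simp
    · funext ⟨n, t⟩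
      simp [hatSnd]
  · convert (h u).act (MvPolynomial.X 1) using 1
    · funext ⟨n, t⟩
      simp
    · funext ⟨n, t⟩
      simp [hatSnd]

/-- Compatibility of polynomial actions with an operation on families may be checked on the
variables. -/
theorem act3_comp (π : ℤ × ℤ × ℤ → ℤ × ℤ × ℤ)
    (φ : MvPolynomial (Fin 3) ℂ →ₐ[ℂ] MvPolynomial (Fin 3) ℂ)
    (h : ∀ i (F : ℤ × ℤ × ℤ → W), act exp3 (φ (MvPolynomial.X i)) (F ∘ π) =
      act exp3 (MvPolynomial.X i) F ∘ π) (r : MvPolynomial (Fin 3) ℂ) (F : ℤ × ℤ × ℤ → W) :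
    act exp3 (φ r) (F ∘ π) = act exp3 r F ∘ π := by
  refine act_mem_of_generators (act exp3) ((act exp3).comp φ)
    (LinearMap.graph (LinearMap.funLeft ℂ W π)) (fun i S G hG => ?_) r (s := F) (g := F ∘ π) ?_
  · rw [LinearMap.mem_graph_iff] at hG ⊢
    dsimp only at hG ⊢
    rw [hG]
    exact h i S
  · rw [LinearMap.mem_graph_iff]
    rfl

/-- The polynomial `p(x₁, x₀, x₂)`. -/
def swapPoly : MvPolynomial (Fin 3) ℂ →ₐ[ℂ] MvPolynomial (Fin 3) ℂ :=
  MvPolynomial.aeval ![MvPolynomial.X 1, MvPolynomial.X 0, MvPolynomial.X 2]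

/-- The polynomial `p(x₁, x₂, x₀)`. -/
def rotPoly : MvPolynomial (Fin 3) ℂ →ₐ[ℂ] MvPolynomial (Fin 3) ℂ :=
  MvPolynomial.aeval ![MvPolynomial.X 1, MvPolynomial.X 2, MvPolynomial.X 0]

/-- The polynomial `p(x₂, x₀, x₁)`. -/
def unrotPoly : MvPolynomial (Fin 3) ℂ →ₐ[ℂ] MvPolynomial (Fin 3) ℂ :=
  MvPolynomial.aeval ![MvPolynomial.X 2, MvPolynomial.X 0, MvPolynomial.X 1]

theorem act_swapPoly (r : MvPolynomial (Fin 3) ℂ) (F : ℤ × ℤ × ℤ → W) :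
    act exp3 (swapPoly r) (fun g => F (g.2.1, g.1, g.2.2)) =
      fun g => act exp3 r F (g.2.1, g.1, g.2.2) := by
  refine act3_comp (fun g => (g.2.1, g.1, g.2.2)) swapPoly (fun i F => ?_) r F
  funext ⟨m, n, t⟩
  fin_cases i <;> simp [swapPoly]

theorem act_rotPoly (r : MvPolynomial (Fin 3) ℂ) (F : ℤ × ℤ × ℤ → W) :
    act exp3 (rotPoly r) (fun g => F (g.2.1, g.2.2, g.1)) =
      fun g => act exp3 r F (g.2.1, g.2.2, g.1) := by
  refine act3_comp (fun g => (g.2.1, g.2.2, g.1)) rotPoly (fun i F => ?_) r F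
  funext ⟨m, n, t⟩
  fin_cases i <;> simp [rotPoly]

theorem act_unrotPoly (r : MvPolynomial (Fin 3) ℂ) (F : ℤ × ℤ × ℤ → W) :
    act exp3 (unrotPoly r) (fun g => F (g.2.2, g.1, g.2.1)) =
      fun g => act exp3 r F (g.2.2, g.1, g.2.1) := by
  refine act3_comp (fun g => (g.2.2, g.1, g.2.1)) unrotPoly (fun i F => ?_) r F
  funext ⟨m, n, t⟩
  fin_cases i <;> simp [unrotPoly]

theorem subst_act_fst {S : ℤ × ℤ × ℤ → W} (hS : ∀ t, TruncSnd fun g => S (g.1, g.2, t))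
    (r : MvPolynomial (Fin 3) ℂ) (t a b : ℤ) :
    subst (fun g => act exp3 r S (g.1, g.2, t)) (a, b) =
      act exp3 (hatFst r) (fun k => subst (fun g => S (g.1, g.2, k.2.2)) (k.1, k.2.1))
        (a, b, t) := by
  let R : Submodule ℂ ((ℤ × ℤ × ℤ → W) × (ℤ × ℤ × ℤ → W)) :=
    { carrier := {P | ∀ t, ((fun g : ℤ × ℤ => P.1 (g.1, g.2, t)),
        fun g : ℤ × ℤ => P.2 (g.1, g.2, t)) ∈ substGraph W}
      add_mem' := fun {P Q} hP hQ u => (substGraph W).add_mem (hP u) (hQ u)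
      zero_mem' := fun u => (substGraph W).zero_mem
      smul_mem' := fun c {P} hP u => (substGraph W).smul_mem c (hP u) }
  have h := act_mem_of_generators (act exp3) ((act exp3).comp hatFst) R
    (fun i S G h => ?_) r (s := S)
    (g := fun k => subst (fun g => S (g.1, g.2, k.2.2)) (k.1, k.2.1)) fun t => ⟨hS t, rfl⟩
  · exact (congrFun (h t).2 (a, b)).symm
  · intro t
    replace h : ∀ t, ((fun g : ℤ × ℤ => S (g.1, g.2, t)),
        fun g : ℤ × ℤ => G (g.1, g.2, t)) ∈ substGraph W := h
    fin_cases i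
    · convert subst_mem_act (h t) (MvPolynomial.X 0) using 2
      · funext ⟨m, n⟩
        simp
      · funext ⟨m, n⟩
        simp [hatFst]
    · convert subst_mem_act (h t) (MvPolynomial.X 1) using 2
      · funext ⟨m, n⟩
        simp
      · funext ⟨m, n⟩
        simp [hatFst]
    · convert h (t - 1) using 2
      · funext ⟨m, n⟩
        simp
      · funext ⟨m, n⟩
        simp [hatFst]

/-- The coefficients of `a(x₁) b(x₂) c(x) w`. -/
def tripleFam (a b c : EW W) (w : W) : ℤ × ℤ × ℤ → W :=
  fun g => mf a (mf b (mf c w (-g.2.2 - 1)) (-g.2.1 - 1)) (-g.1 - 1)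

theorem pairPoly_ne_zero {p : MvPolynomial (Fin 2) ℂ} (hp : p ≠ 0) (r : ℕ) :
    pairPoly p r ≠ 0 := by
  refine Finset.prod_ne_zero_iff.2 fun ij hij => ?_
  have h1 : ij.1 < ij.2 := (Finset.mem_filter.1 hij).2
  have h2 : Function.Injective ![ij.1, ij.2] := by
    intro i j h
    fin_cases i <;> fin_cases j <;> simp_all [h1.ne, h1.ne']
  exact (map_ne_zero_iff _ (MvPolynomial.rename_injective _ h2)).2 hp

theorem mulPolyN_eq_act (P : MvPolynomial (Fin 3) ℂ) (a b c : EW W) (w : W) (m n t : ℤ) :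
    mulPolyN P (seqCoeff ![a, b, c] w) ![m, n, t] = act exp3 P (tripleFam a b c w) (m, n, t) := by
  rw [act_apply]
  rfl

theorem act3_X0_pow (S : ℤ × ℤ × ℤ → W) (k : ℕ) (m n t : ℤ) :
    act exp3 (MvPolynomial.X 0 ^ k) S (m, n, t) = S (m - k, n, t) := by
  induction k generalizing m with
  | zero => simp
  | succ k ih =>
    rw [pow_succ', act_mul, act3_X0, ih]
    congr 2; push_cast; ring

theorem act3_X1_pow (S : ℤ × ℤ × ℤ → W) (k : ℕ) (m n t : ℤ) :
    act exp3 (MvPolynomial.X 1 ^ k) S (m, n, t) = S (m, n - k, t) := by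
  induction k generalizing n with
  | zero => simp
  | succ k ih =>
    rw [pow_succ', act_mul, act3_X1, ih]
    congr 3; push_cast; ring

theorem QCSet.exists_triple {S : Set (EW W)} (hS : QCSet S) {a b c : EW W} (ha : a ∈ S)
    (hb : b ∈ S) (hc : c ∈ S) (w : W) :
    ∃ r : MvPolynomial (Fin 3) ℂ, r ≠ 0 ∧ ∃ N : ℤ, ∀ m n t, (m < 0 ∨ n < 0 ∨ t < N) →
      act exp3 r (tripleFam a b c w) (m, n, t) = 0 := by
  obtain ⟨p, hp, h⟩ := hS 3 ![a, b, c] fun i => by fin_cases i <;> assumption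
  obtain ⟨N, hN⟩ := h w
  refine ⟨MvPolynomial.X 0 ^ (-N).toNat * (MvPolynomial.X 1 ^ (-N).toNat * pairPoly p 3),
    mul_ne_zero (pow_ne_zero _ (MvPolynomial.X_ne_zero 0))
      (mul_ne_zero (pow_ne_zero _ (MvPolynomial.X_ne_zero 1)) (pairPoly_ne_zero hp 3)), N,
    fun m n t hmnt => ?_⟩
  rw [act_mul, act3_X0_pow, act_mul, act3_X1_pow, ← mulPolyN_eq_act]
  refine hN _ ?_
  rcases hmnt with h | h | h
  · exact ⟨0, by show m - (-N).toNat < N; omega⟩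
  · exact ⟨1, by show n - (-N).toNat < N; omega⟩
  · exact ⟨2, h⟩

/-- The coefficients of `Y_ℰ(a, z) (Y_ℰ(b, y) c)` at `w`. -/
def prodProdE (a b c : EW W) (w : W) : ℤ × ℤ × ℤ → W :=
  fun g => mf (YE a (YE b c (-g.2.1 - 1)) (-g.1 - 1)) w (-g.2.2 - 1)

/-- The coefficients of `Y_ℰ(Y_ℰ(a, z) b, y) c` at `w`. -/
def iterE (a b c : EW W) (w : W) : ℤ × ℤ × ℤ → W :=
  fun g => mf (YE (YE a b (-g.1 - 1)) c (-g.2.1 - 1)) w (-g.2.2 - 1)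

theorem SubstEqSnd.eq_subst {S G H : ℤ × ℤ × ℤ → W} (h : SubstEqSnd S G)
    {r : MvPolynomial (Fin 3) ℂ} (hH : NVA.act exp3 r S = H) (hR : ∀ u, Reg fun g => H (u, g))
    (u : ℤ) (g : ℤ × ℤ) : NVA.act exp3 (hatSnd r) G (u, g) = subst (fun g => H (u, g)) g := by
  subst hH
  exact congrFun ((h.act r u).eq_subst (hR u)) g

theorem hatSnd_unrotPoly_hatSnd_rotPoly (r : MvPolynomial (Fin 3) ℂ) :
    hatSnd (unrotPoly (hatSnd (rotPoly r))) =
      hatFst (swapPoly (hatSnd (swapPoly (hatSnd r)))) := by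
  have : (((hatSnd.comp unrotPoly).comp hatSnd).comp rotPoly) =
      ((((hatFst.comp swapPoly).comp hatSnd).comp swapPoly).comp hatSnd) := by
    refine MvPolynomial.algHom_ext fun i => ?_
    simp only [AlgHom.comp_apply]
    revert i
    simp only [Fin.forall_fin_succ]
    simp [hatSnd, hatFst, unrotPoly, rotPoly, swapPoly, add_assoc]
  simpa only [AlgHom.comp_apply] using DFunLike.congr_fun this r

theorem hatSnd_unrotPoly_hatSnd_rotPoly_ne_zero {r : MvPolynomial (Fin 3) ℂ} (hr : r ≠ 0) :
    hatSnd (unrotPoly (hatSnd (rotPoly r))) ≠ 0 := by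
  have : ((((MvPolynomial.aeval ![MvPolynomial.X 0 - MvPolynomial.X 1,
      MvPolynomial.X 1 - MvPolynomial.X 2, (MvPolynomial.X 2 : MvPolynomial (Fin 3) ℂ)]).comp
      hatSnd).comp unrotPoly).comp hatSnd).comp rotPoly = AlgHom.id ℂ _ := by
    refine MvPolynomial.algHom_ext fun i => ?_
    simp only [AlgHom.comp_apply]
    revert i
    simp only [Fin.forall_fin_succ]
    simp [hatSnd, unrotPoly, rotPoly]
  intro h
  have h2 := DFunLike.congr_fun this r
  simp only [AlgHom.comp_apply, h, map_zero, AlgHom.id_apply] at h2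
  exact hr h2.symm

/-- Weak associativity on `ℰ(W)`, up to a polynomial factor. -/
theorem QCSet.exists_weak_assoc {S : Set (EW W)} (hS : QCSet S)
    (hcl : ∀ a ∈ S, ∀ b ∈ S, ∀ n : ℤ, YE a b n ∈ S) {a b c : EW W} (ha : a ∈ S)
    (hb : b ∈ S) (hc : c ∈ S) (w : W) :
    ∃ q : MvPolynomial (Fin 3) ℂ, hatFst q ≠ 0 ∧ ∀ z y x,
      act exp3 (hatFst q) (iterE a b c w) (z, y, x) =
        subst (fun g => act exp3 q (prodProdE a b c w) (g.1, g.2, x)) (z, y) := by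
  obtain ⟨r, hr, N, hH⟩ := hS.exists_triple ha hb hc w
  have hB := hatSnd_unrotPoly_hatSnd_rotPoly r
  have hne := hatSnd_unrotPoly_hatSnd_rotPoly_ne_zero hr
  refine ⟨swapPoly (hatSnd (swapPoly (hatSnd r))), hB ▸ hne, fun z y x => ?_⟩
  rw [← hB]
  generalize hHdef : act exp3 r (tripleFam a b c w) = H at hH
  have rH : ∀ m, Reg fun g => H (m, g) := fun m => ⟨N, fun n t h => hH m n t (.inr h)⟩
  -- the iterated product
  have i1 : SubstEqSnd (fun g => tripleFam a b c w (g.2.1, g.2.2, g.1))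
      fun g => mf (YE a b (-g.2.1 - 1)) (mf c w (-g.1 - 1)) (-g.2.2 - 1) :=
    fun t => (hS.qcPair ha hb).substEq (mf c w (-t - 1))
  have i2 := i1.eq_subst (H := fun g => H (g.2.1, g.2.2, g.1)) (r := rotPoly r) ((act_rotPoly r _).trans (by rw [hHdef]))
    fun t => ⟨0, fun m n h => hH m n t (by omega)⟩
  have i3 : SubstEqSnd (fun g => mf (YE a b (-g.1 - 1)) (mf c w (-g.2.2 - 1)) (-g.2.1 - 1))
      (iterE a b c w) := fun u => (hS.qcPair (hcl a ha b hb (-u - 1)) hc).substEq w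
  have i4 := i3.eq_subst
    (H := fun g => subst (fun k => H (k.1, k.2, g.2.2)) (g.1, g.2.1)) (r := unrotPoly (hatSnd (rotPoly r)))
    ((act_unrotPoly (hatSnd (rotPoly r))
      fun g => mf (YE a b (-g.2.1 - 1)) (mf c w (-g.1 - 1)) (-g.2.2 - 1)).trans
      (funext fun g => i2 _ _)) (fun u => ⟨N, fun n t h => ?_⟩) z (y, x)
  swap
  · rcases h with h | h
    · exact subst_of_snd_lt (fun m n hn => hH m n t (.inr (.inl hn))) u h
    · exact finsum_eq_zero_of_forall_eq_zero fun i => by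
        dsimp only; rw [hH _ _ _ (.inr (.inr h)), smul_zero]
  rw [i4]
  -- the product of products
  have j1 : SubstEqSnd (tripleFam a b c w)
      fun g => mf a (mf (YE b c (-g.2.1 - 1)) w (-g.2.2 - 1)) (-g.1 - 1) :=
    fun m => ((hS.qcPair hb hc).substEq w).map (modeMap a (-m - 1))
  have j2 := j1.eq_subst hHdef rH
  have j3 : SubstEqSnd (fun g => mf a (mf (YE b c (-g.1 - 1)) w (-g.2.2 - 1)) (-g.2.1 - 1))
      fun g => mf (YE a (YE b c (-g.1 - 1)) (-g.2.1 - 1)) w (-g.2.2 - 1) :=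
    fun u => (hS.qcPair ha (hcl b hb c hc (-u - 1))).substEq w
  have j4 := j3.eq_subst
    (H := fun g => subst (fun l => H (g.2.1, l)) (g.1, g.2.2)) (r := swapPoly (hatSnd r))
    ((act_swapPoly (hatSnd r)
      fun g => mf a (mf (YE b c (-g.2.1 - 1)) w (-g.2.2 - 1)) (-g.1 - 1)).trans
      (funext fun g => j2 _ _)) fun u => ⟨N - u, fun m t h => ?_⟩
  swap
  · rcases h with h | h
    · exact finsum_eq_zero_of_forall_eq_zero fun i => by
        dsimp only; rw [hH _ _ _ (.inl h), smul_zero]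
    · exact subst_of_add_lt (fun n t hnt => hH m n t (.inr hnt)) (by dsimp only; omega)
  have j5 : ∀ m u t, act exp3 (swapPoly (hatSnd (swapPoly (hatSnd r)))) (prodProdE a b c w)
      (m, u, t) = subst (fun k => subst (fun l => H (k.1, l)) (u, k.2)) (m, t) := by
    intro m u t
    refine (congrFun (act_swapPoly (hatSnd (swapPoly (hatSnd r)))
      fun g => mf (YE a (YE b c (-g.1 - 1)) (-g.2.1 - 1)) w (-g.2.2 - 1)) (m, u, t)).trans ?_
    exact j4 u (m, t)
  simp only [j5]
  exact (subst_subst_subst hH z y x).symm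

end ThreeVariables

/-! ### Quasi modules and homomorphisms into `ℰ(W)` -/

section QuasiModule

variable {V W : Type*} [AddCommGroup V] [Module ℂ V] [AddCommGroup W] [Module ℂ W]

theorem act2_X0_pow (F : ℤ × ℤ → W) (k : ℕ) (m t : ℤ) :
    act exp2 (MvPolynomial.X 0 ^ k) F (m, t) = F (m - k, t) := by
  induction k generalizing m with
  | zero => simp
  | succ k ih =>
    rw [pow_succ', act_mul, act2_X0, ih]
    congr 2; push_cast; ring

theorem act2_X1_pow (F : ℤ × ℤ → W) (k : ℕ) (m t : ℤ) :
    act exp2 (MvPolynomial.X 1 ^ k) F (m, t) = F (m, t - k) := by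
  induction k generalizing t with
  | zero => simp
  | succ k ih =>
    rw [pow_succ', act_mul, act2_X1, ih]
    congr 2; push_cast; ring

theorem act3_X0_add_X1_pow (H : ℤ × ℤ × ℤ → W) (l : ℕ) (z y t : ℤ) :
    act exp3 ((MvPolynomial.X 0 + MvPolynomial.X 1) ^ l) H (z, y, t) =
      act exp2 ((MvPolynomial.X 0 + MvPolynomial.X 1) ^ l) (fun g => H (g.1, g.2, t)) (z, y) := by
  induction l generalizing z y with
  | zero => simp
  | succ l ih => simp only [pow_succ', act_mul, map_add, LinearMap.add_apply, Pi.add_apply,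
      act3_X0, act3_X1, act2_X0, act2_X1, ih]

theorem X0_add_X1_ne_zero :
    (MvPolynomial.X 0 + MvPolynomial.X 1 : MvPolynomial (Fin 3) ℂ) ≠ 0 := fun h => by
  simpa using congrArg (MvPolynomial.eval ![1, 0, 0]) h

theorem hat_eq_sum (f : MvPolynomial (Fin 2) ℂ) :
    hat f = ∑ d ∈ f.support, ∑ i ∈ Finset.range (d 0 + 1),
      (MvPolynomial.coeff d f * ((d 0).choose i : ℂ)) •
        (MvPolynomial.X 1 ^ d 1 * (MvPolynomial.X 1 ^ i * MvPolynomial.X 0 ^ (d 0 - i))) := by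
  rw [hat, MvPolynomial.aeval_def, MvPolynomial.eval₂_eq']
  refine Finset.sum_congr rfl fun d _ => ?_
  simp only [Fin.prod_univ_two, Matrix.cons_val_zero, Matrix.cons_val_one,
    add_comm (MvPolynomial.X 0 : MvPolynomial (Fin 2) ℂ), add_pow, Finset.sum_mul, Finset.mul_sum,
    MvPolynomial.algebraMap_eq]
  refine Finset.sum_congr rfl fun i _ => ?_
  rw [MvPolynomial.smul_eq_C_mul, map_mul, map_natCast]
  ring

theorem mulSubPoly_eq_act (f : MvPolynomial (Fin 2) ℂ) (F : ℤ → ℤ → W) (a b : ℤ) :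
    mulSubPoly f F a b = act exp2 (hat f) (fun g => F g.1 g.2) (a, b) := by
  rw [hat_eq_sum, mulSubPoly]
  simp only [map_sum, map_smul, LinearMap.sum_apply, LinearMap.smul_apply, Finset.sum_apply,
    Pi.smul_apply]
  refine Finset.sum_congr rfl fun d _ => Finset.sum_congr rfl fun i hi => ?_
  rw [act_mul, act2_X1_pow, act_mul, act2_X1_pow, act2_X0_pow]
  have := Finset.mem_range.1 hi
  congr 2
  · push_cast [Nat.cast_sub (Nat.lt_succ_iff.1 this)]; rfl
  · dsimp only; ring

theorem prodCE_eq_subst (φ : V →ₗ[ℂ] EW W) (u v : V) (w : W) (a b : ℤ) :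
    prodCE (fun x => mf (φ x)) (fun x => mf (φ x)) u v w a b =
      subst (prodFam (φ u) (φ v) w) (a, b) := by
  have hinj : Function.Injective fun i : ℕ => a + (i : ℤ) := fun i j h => by
    dsimp only at h; omega
  set F : ℤ → W := fun m => binom m (m - a).toNat •
    mf (φ u) (mf (φ v) w (-(b - (m - a)) - 1)) (-m - 1) with hF
  have h1 : subst (prodFam (φ u) (φ v) w) (a, b) = ∑ᶠ i : ℕ, F (a + i) := by
    refine finsum_congr fun i => ?_
    simp only [hF, prodFam, Fab, add_sub_cancel_left, Int.toNat_natCast]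
  rw [h1, ← finsum_mem_range hinj, finsum_mem_def]
  refine finsum_congr fun m => ?_
  by_cases h : a ≤ m
  · rw [if_pos h, Set.indicator_of_mem (Set.mem_range.2 ⟨(m - a).toNat, by omega⟩)]
  · rw [if_neg h, Set.indicator_of_notMem]
    rintro ⟨i, rfl⟩
    dsimp only at h
    omega

/-- The coefficients of `φ(Y(u, x₀) v, x₂) w`. -/
def assocFam (A : NLVA V) (φ : V →ₗ[ℂ] EW W) (u v : V) (w : W) : ℤ × ℤ → W :=
  fun g => mf (φ (Yf A u v (-g.1 - 1))) w (-g.2 - 1)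

theorem assocFam_LL2 (A : NLVA V) (φ : V →ₗ[ℂ] EW W) (u v : V) (w : W) :
    LL2 (assocFam A φ u v w) := by
  refine ⟨?_, fun m => mf_trunc (φ (Yf A u v (-m - 1))) w⟩
  obtain ⟨N, hN⟩ := mf_trunc (A.Y u) v
  refine ⟨N, fun m t hm => ?_⟩
  simp only [assocFam, Yf, hN m hm, map_zero, mf_zero_apply]

theorem assoc_iff_act_eq (A : NLVA V) (φ : V →ₗ[ℂ] EW W) (f : MvPolynomial (Fin 2) ℂ) (u v : V)
    (w : W) :
    (∀ a b, mulSubPoly f (prodCE (fun x => mf (φ x)) (fun x => mf (φ x)) u v w) a b =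
      mulSubPoly f (assocCE (Yf A) (fun x => mf (φ x)) u v w) a b) ↔
    act exp2 (hat f) (subst (prodFam (φ u) (φ v) w)) =
      act exp2 (hat f) (assocFam A φ u v w) := by
  have h : (fun g : ℤ × ℤ => prodCE (fun x => mf (φ x)) (fun x => mf (φ x)) u v w g.1 g.2) =
      subst (prodFam (φ u) (φ v) w) := funext fun g => prodCE_eq_subst φ u v w g.1 g.2
  simp only [mulSubPoly_eq_act, h, funext_iff, Prod.forall]
  rfl

/-- A quasi module map intertwines the products of `V` with those of `ℰ(W)`. -/
theorem IsQuasiModule.map_Yf {A : NLVA V} {φ : V →ₗ[ℂ] EW W} (h : IsQuasiModule A φ) {u v : V}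
    (huv : QCPair (φ u) (φ v)) (n : ℤ) : φ (Yf A u v n) = YE (φ u) (φ v) n := by
  refine (YE_eq_of_prodE (c := fun n => φ (Yf A u v n)) (fun w => ?_) n).symm
  obtain ⟨p, hp, h1⟩ := (huv.substEq w).exists_act_eq (prodFam_truncSnd _ _ w)
  obtain ⟨g, hg, h2⟩ := h.2 u v w
  have h3 := (assoc_iff_act_eq A φ g u v w).1 h2
  have hLL : LL2 (prodE (φ u) (φ v) w - assocFam A φ u v w) :=
    (LL2sub W).sub_mem (huv.substEq w).1 (assocFam_LL2 A φ u v w)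
  refine sub_eq_zero.1 (hLL.cancel (mul_ne_zero (hat_ne_zero hp) (hat_ne_zero hg)) ?_)
  rw [map_sub, sub_eq_zero, act_mul _ _ _ (assocFam A φ u v w), ← h3, ← act_mul,
    mul_comm, act_mul, act_mul, h1]

theorem IsQuasiModule.map_one {A : NLVA V} {φ : V →ₗ[ℂ] EW W} (h : IsQuasiModule A φ) :
    φ A.one = oneE :=
  mf_ext fun w n => by rw [h.1]; simp

theorem isQuasiModule_of_map_Yf {A : NLVA V} {φ : V →ₗ[ℂ] EW W} (h1 : φ A.one = oneE)
    (hqc : ∀ u v, QCPair (φ u) (φ v))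
    (h : ∀ u v n, φ (Yf A u v n) = YE (φ u) (φ v) n) : IsQuasiModule A φ := by
  refine ⟨fun w n => by rw [h1]; simp, fun u v w => ?_⟩
  obtain ⟨p, hp, h2⟩ := ((hqc u v).substEq w).exists_act_eq (prodFam_truncSnd _ _ w)
  refine ⟨p, hp, (assoc_iff_act_eq A φ p u v w).2 (h2.trans ?_)⟩
  congr 1
  funext g
  simp only [prodE, assocFam, h]

theorem IsQuasiModule.map_mem {A : NLVA V} {U : Submodule ℂ V} (hgen : Generates A U)
    {φ : V →ₗ[ℂ] EW W} (h : IsQuasiModule A φ) {U' : Submodule ℂ (EW W)}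
    (hqc : QCSet (U' : Set (EW W))) (hcl : ∀ a ∈ U', ∀ b ∈ U', ∀ n : ℤ, YE a b n ∈ U')
    (hone : oneE ∈ U') (hU : ∀ u ∈ U, φ u ∈ U') (v : V) : φ v ∈ U' := by
  have : U'.comap φ = ⊤ := hgen _ ⟨by simpa [h.map_one] using hone, fun a ha b hb n => by
    rw [Submodule.mem_comap, h.map_Yf (hqc.qcPair ha hb)]
    exact hcl _ ha _ hb n⟩ hU
  exact Submodule.mem_comap.1 (this ▸ Submodule.mem_top)

theorem YE_zero_left {a b : EW W} (h : QCPair a b) (n : ℤ) : YE 0 b n = 0 := by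
  have h0 : QCPair ((0 : ℂ) • a) b := by
    rw [zero_smul]
    exact ⟨1, one_ne_zero, fun w => ⟨0, fun m t _ => by simp [mulPoly_eq_act, Fab]⟩⟩
  have h1 := YE_smul_left 0 h h0 n
  rwa [zero_smul, zero_smul] at h1

theorem LL3_prodE_sub_assocFam (A : NLVA V) {f : V →ₗ[ℂ] EW W} {v : V}
    (h : ∀ u, QCPair (f u) (f v)) (a b : V) (w : W) :
    LL3 fun g => (prodE (f (Yf A a b (-g.1 - 1))) (f v) w -
      assocFam A f (Yf A a b (-g.1 - 1)) v w) g.2 := by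
  obtain ⟨N, hN⟩ := mf_trunc (A.Y a) b
  have h1 : ∀ n, YE (f 0) (f v) n = 0 := fun n => by
    rw [map_zero]
    exact YE_zero_left (h v) n
  have h2 : ∀ n, Yf A 0 v n = 0 := fun n => by rw [Yf, map_zero, mf_zero_apply]
  refine ⟨⟨N, fun z g hz => ?_⟩, fun z => ?_⟩
  · have h0 : Yf A a b (-z - 1) = 0 := hN z hz
    simp only [Pi.sub_apply, prodE, assocFam, h0, h1, h2]
    rw [map_zero, sub_self]
  · exact (LL2sub W).sub_mem ((h (Yf A a b (-z - 1))).substEq w).1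
      (assocFam_LL2 A f (Yf A a b (-z - 1)) v w)

/-- A linear map `f : V → U'` compatible with the vacuum and with the left actions of
`a` and `b` is compatible with the left action of `a_m b`. -/
theorem map_Yf_Yf {A : NLVA V} {f : V →ₗ[ℂ] EW W} {U' : Set (EW W)} (hqc : QCSet U')
    (hcl : ∀ a ∈ U', ∀ b ∈ U', ∀ n : ℤ, YE a b n ∈ U') (hf : ∀ v, f v ∈ U') {a b : V}
    (ha : ∀ v n, f (Yf A a v n) = YE (f a) (f v) n)
    (hb : ∀ v n, f (Yf A b v n) = YE (f b) (f v) n) (m : ℤ) (v : V) (n : ℤ) :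
    f (Yf A (Yf A a b m) v n) = YE (f (Yf A a b m)) (f v) n := by
  refine mf_ext fun w k => ?_
  obtain ⟨q, hq, hB⟩ := hqc.exists_weak_assoc hcl (hf a) (hf b) (hf v) w
  obtain ⟨l, hl⟩ := A.wassoc a b v
  have hl := (assoc_iff_act_eq A A.Y _ a b v).1 hl
  set L : ℤ → V →ₗ[ℂ] W := fun t => (modeAt w (-t - 1)).comp f with hL
  set B' : ℤ × ℤ × ℤ → W :=
    fun g => L g.2.2 (assocFam A A.Y a b v (g.1, g.2.1)) with hB'
  have hA : ∀ t, (fun g : ℤ × ℤ => prodProdE (f a) (f b) (f v) w (g.1, g.2, t)) =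
      fun g => L t (prodFam (A.Y a) (A.Y b) v g) := by
    intro t
    funext g
    show _ = mf (f (Yf A a (Yf A b v (-g.2 - 1)) (-g.1 - 1))) w (-t - 1)
    rw [ha, hb]
    rfl
  have hT : ∀ t, TruncSnd fun g : ℤ × ℤ => prodProdE (f a) (f b) (f v) w (g.1, g.2, t) := by
    intro t
    rw [hA]
    obtain ⟨N, hN⟩ := prodFam_truncSnd (A.Y a) (A.Y b) v
    exact ⟨N, fun m u h => by simp only [hN m u h, map_zero]⟩
  set G : ℤ × ℤ × ℤ → W := fun k =>
    subst (fun g => prodProdE (f a) (f b) (f v) w (g.1, g.2, k.2.2)) (k.1, k.2.1) with hG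
  have h1 : act exp3 (hatFst q) (iterE (f a) (f b) (f v) w) = act exp3 (hatFst q) G := by
    funext ⟨z, y, t⟩
    rw [hB, subst_act_fst hT]
  have h2 : act exp3 ((MvPolynomial.X 0 + MvPolynomial.X 1) ^ l) B' =
      act exp3 ((MvPolynomial.X 0 + MvPolynomial.X 1) ^ l) G := by
    funext ⟨z, y, t⟩
    have hG' : (fun g : ℤ × ℤ => G (g.1, g.2, t)) =
        fun g => L t (subst (prodFam (A.Y a) (A.Y b) v) g) := by
      rw [← subst_map (prodFam_truncSnd _ _ v), ← hA]
    rw [act3_X0_add_X1_pow, act3_X0_add_X1_pow, hG', act_map, hB']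
    rw [map_pow, hat_X0] at hl
    refine (congrFun (act_map exp2 _ (L t) (assocFam A A.Y a b v)) (z, y)).trans ?_
    rw [hl]
  have hqD : (MvPolynomial.X 0 + MvPolynomial.X 1) ^ l * hatFst q ≠ 0 :=
    mul_ne_zero (pow_ne_zero _ X0_add_X1_ne_zero) hq
  have hI : ∀ z y t, iterE (f a) (f b) (f v) w (z, y, t) =
      prodE (f (Yf A a b (-z - 1))) (f v) w (y, t) := fun z y t => by rw [ha]; rfl
  have hD := LL3_prodE_sub_assocFam A (fun u => hqc.qcPair (hf u) (hf v)) a b w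
  have hD' : (fun g : ℤ × ℤ × ℤ => (prodE (f (Yf A a b (-g.1 - 1))) (f v) w -
      assocFam A f (Yf A a b (-g.1 - 1)) v w) g.2) = iterE (f a) (f b) (f v) w - B' :=
    funext fun ⟨z, y, t⟩ => congrArg (· - B' (z, y, t)) (hI z y t).symm
  rw [hD'] at hD
  have h0 := hD.cancel hqD (by
    rw [map_sub, sub_eq_zero, act_mul, h1, ← act_mul, mul_comm, act_mul, act_mul, h2])
  have h3 := congrFun h0 (-m - 1, -n - 1, -k - 1)
  rw [Pi.sub_apply, hI, Pi.zero_apply, sub_eq_zero] at h3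
  simpa [prodE, hB', hL, assocFam, Yf, modeAt_apply] using h3.symm

theorem map_Yf_of_generates {A : NLVA V} {U : Submodule ℂ V} (hgen : Generates A U)
    {f : V →ₗ[ℂ] EW W} {U' : Submodule ℂ (EW W)} (hqc : QCSet (U' : Set (EW W)))
    (hcl : ∀ a ∈ U', ∀ b ∈ U', ∀ n : ℤ, YE a b n ∈ U') (hf : ∀ v, f v ∈ U')
    (h1 : f A.one = oneE) (hU : ∀ u ∈ U, ∀ v n, f (Yf A u v n) = YE (f u) (f v) n)
    (u v : V) (n : ℤ) : f (Yf A u v n) = YE (f u) (f v) n := by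
  have hp : ∀ u v, QCPair (f u) (f v) := fun u v => hqc.qcPair (hf u) (hf v)
  let P : Submodule ℂ V :=
    { carrier := {a | ∀ v n, f (Yf A a v n) = YE (f a) (f v) n}
      add_mem' := fun {a b} ha hb v n => by
        have : Yf A (a + b) v n = Yf A a v n + Yf A b v n := by
          rw [Yf, map_add, mf_add_apply]; rfl
        rw [this, map_add, ha, hb, map_add,
          YE_add_left (hp a v) (hp b v) (by rw [← map_add]; exact hp _ v)]
      zero_mem' := fun v n => by
        rw [Yf, map_zero, mf_zero_apply, map_zero, YE_zero_left (hp v v)]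
      smul_mem' := fun c a ha v n => by
        have : Yf A (c • a) v n = c • Yf A a v n := by
          rw [Yf, map_smul, mf_smul_apply]; rfl
        rw [this, map_smul, ha, map_smul,
          YE_smul_left c (hp a v) (by rw [← map_smul]; exact hp _ v)] }
  have hP : P = ⊤ := hgen P ⟨fun v n => by
      rw [h1, YE_oneE_left (h1 ▸ hp A.one v), Yf, A.vac]
      split_ifs <;> simp, fun a ha b hb m v n => map_Yf_Yf hqc hcl hf ha hb m v n⟩ hU
  have hu : u ∈ P := hP ▸ Submodule.mem_top
  exact hu v n

end QuasiModule

/-- cf. Theorem 6.4 / `twva-module`.  Let `V` be a nonlocal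
vertex algebra, `U` a generating subspace, and `W` a vector space with a linear map
`Y_W⁰ : U → Hom(W, W((x)))` whose image is quasi compatible.  Then `Y_W⁰` extends
(uniquely) to a quasi `V`-module structure `Y_W` on `W` if and only if there is a
linear map `f : V → ⟨Y_W⁰(U)⟩` with `f(1) = 1_W` and `f(uₙv) = u(x)ₙ f(v)` for
`u ∈ U`, `v ∈ V`, `n ∈ ℤ`. -/
theorem statement19 {V W : Type*} [AddCommGroup V] [Module ℂ V]
    [AddCommGroup W] [Module ℂ W]
    (A : NLVA V) (U : Submodule ℂ V) (hgen : Generates A U)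
    (YW0 : ↥U →ₗ[ℂ] EW W)
    (hqc : QCSet (Set.range fun u : ↥U => YW0 u))
    (U' : Submodule ℂ (EW W)) (hU' : IsGenVA (Set.range fun u : ↥U => YW0 u) U') :
    (∃! YW : V →ₗ[ℂ] EW W, (∀ u : ↥U, YW (u : V) = YW0 u) ∧ IsQuasiModule A YW) ↔
    (∃ f : V →ₗ[ℂ] EW W, (∀ v : V, f v ∈ U') ∧ f A.one = oneE ∧
      ∀ (u : ↥U) (v : V) (n : ℤ), f (Yf A (u : V) v n) = YE (YW0 u) (f v) n) := by
  obtain ⟨hqc', hcl, hone, hS, -⟩ := hU'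
  have hU0 : ∀ φ : V →ₗ[ℂ] EW W, (∀ u : ↥U, φ (u : V) = YW0 u) → ∀ u ∈ U, φ u ∈ U' :=
    fun φ hφ u hu => by
      rw [hφ ⟨u, hu⟩]
      exact hS ⟨⟨u, hu⟩, rfl⟩
  constructor
  · rintro ⟨φ, ⟨hφ, hmod⟩, -⟩
    have hmem := hmod.map_mem hgen hqc' hcl hone (hU0 φ hφ)
    refine ⟨φ, hmem, hmod.map_one, fun u v n => ?_⟩
    rw [hmod.map_Yf (hqc'.qcPair (hmem _) (hmem v)), hφ]
  · rintro ⟨f, hf, h1, hfU⟩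
    have hext : ∀ u : ↥U, f (u : V) = YW0 u := fun u => by
      have h := hfU u A.one (-1)
      rwa [Yf, A.creation1, h1, YE_oneE_right (hqc'.qcPair (hS ⟨u, rfl⟩) hone)] at h
    have hmul := map_Yf_of_generates hgen hqc' hcl hf h1 fun u hu v n => by
      rw [hext ⟨u, hu⟩]
      exact hfU ⟨u, hu⟩ v n
    refine ⟨f, ⟨hext, isQuasiModule_of_map_Yf h1 (fun u v => hqc'.qcPair (hf u) (hf v)) hmul⟩, ?_⟩
    rintro φ ⟨hφ, hmod⟩
    have hmem := hmod.map_mem hgen hqc' hcl hone (hU0 φ hφ)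
    have htop : LinearMap.eqLocus φ f = ⊤ := hgen _ ⟨by
      rw [LinearMap.mem_eqLocus, hmod.map_one, h1], fun a ha b hb n => by
      rw [LinearMap.mem_eqLocus] at ha hb ⊢
      rw [hmod.map_Yf (hqc'.qcPair (hmem a) (hmem b)), hmul, ha, hb]⟩ fun u hu => by
      rw [LinearMap.mem_eqLocus, hφ ⟨u, hu⟩, hext ⟨u, hu⟩]
    ext1 v
    exact LinearMap.mem_eqLocus.1 (htop ▸ Submodule.mem_top)

end NVA
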